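/- arXiv:1310.6626 — 6 statements merged into one kernel-verified Lean document; each statement's English description precedes it below -/
import Mathlib

section
/- Let X be a finite nonempty subset of the unit sphere Ω_m of ℝ^m which is a spherical design of strength t, and let F ∈ ℝ[Y_1, …, Y_m] be a polynomial vanishing at every point of X. If the total degree of F is at most t/2, then the polynomial Nm = Y_1² + ⋯ + Y_m² − 1 divides F. -/
open MvPolynomial MeasureTheory

/-- The rotation-invariant probability measure on the unit sphere of `ℝ^m`
(the normalization of the spherical measure induced by Lebesgue measure). -/
noncomputable def sphereUniform (m : ℕ) :
    Measure (Metric.sphere (0 : EuclideanSpace ℝ (Fin m)) 1) :=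
  ((volume : Measure (EuclideanSpace ℝ (Fin m))).toSphere Set.univ)⁻¹ •
    (volume : Measure (EuclideanSpace ℝ (Fin m))).toSphere

/-- A polynomial function on the unit sphere is continuous. -/
theorem continuous_eval_sphere {m : ℕ} (F : MvPolynomial (Fin m) ℝ) :
    Continuous fun y : Metric.sphere (0 : EuclideanSpace ℝ (Fin m)) 1 =>
      MvPolynomial.eval (fun i => (y : EuclideanSpace ℝ (Fin m)) i) F :=
  (MvPolynomial.continuous_eval F).comp (by fun_prop)

/-- A polynomial whose square has integral zero over the unit sphere vanishes on the sphere. -/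
theorem eval_eq_zero_of_integral_sq_eq_zero {m : ℕ} (F : MvPolynomial (Fin m) ℝ)
    (h : ∫ y, MvPolynomial.eval (fun i => (y : EuclideanSpace ℝ (Fin m)) i) (F ^ 2)
      ∂(sphereUniform m) = 0)
    (y : Metric.sphere (0 : EuclideanSpace ℝ (Fin m)) 1) :
    MvPolynomial.eval (fun i => (y : EuclideanSpace ℝ (Fin m)) i) F = 0 := by
  set μ := (volume : Measure (EuclideanSpace ℝ (Fin m))).toSphere
  have hμ0 : μ Set.univ ≠ 0 := (isOpen_univ.measure_pos μ ⟨y, trivial⟩).ne'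
  rw [sphereUniform, integral_smul_measure, smul_eq_zero] at h
  have h' := h.resolve_left
    (ENNReal.toReal_ne_zero.2 ⟨ENNReal.inv_ne_zero.2 (measure_ne_top μ _), ENNReal.inv_ne_top.2 hμ0⟩)
  have hcont := continuous_eval_sphere (F ^ 2)
  have hint : Integrable (fun y : Metric.sphere (0 : EuclideanSpace ℝ (Fin m)) 1 =>
      MvPolynomial.eval (fun i => (y : EuclideanSpace ℝ (Fin m)) i) (F ^ 2)) μ :=
    hcont.integrable_of_hasCompactSupport (HasCompactSupport.of_compactSpace _)
  have hae := (integral_eq_zero_iff_of_nonneg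
    (fun y => by rw [map_pow]; exact sq_nonneg _) hint).1 h'
  have hy := congrFun ((hcont.ae_eq_iff_eq μ continuous_zero).1 hae) y
  rwa [map_pow, Pi.zero_apply, sq_eq_zero_iff] at hy

/-- A real polynomial vanishing on the unit sphere of `ℝ^(n+1)` is divisible by the
equation of the sphere. -/
theorem sum_X_sq_sub_one_dvd_of_eval_eq_zero {n : ℕ} (F : MvPolynomial (Fin (n + 1)) ℝ)
    (h : ∀ y : Fin (n + 1) → ℝ, ∑ i, y i ^ 2 = 1 → MvPolynomial.eval y F = 0) :
    ((∑ i : Fin (n + 1), MvPolynomial.X i ^ 2) - 1) ∣ F := by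
  set c : MvPolynomial (Fin n) ℝ := (∑ i, MvPolynomial.X i ^ 2) - 1 with hc
  set q : Polynomial (MvPolynomial (Fin n) ℝ) := Polynomial.X ^ 2 + Polynomial.C c with hq
  have hqN : finSuccEquiv ℝ n ((∑ i : Fin (n + 1), MvPolynomial.X i ^ 2) - 1) = q := by
    rw [Fin.sum_univ_succ, map_sub, map_add, map_sum, map_one]
    simp only [map_pow, finSuccEquiv_X_zero, finSuccEquiv_X_succ, hq, hc, map_sub, map_sum,
      map_one]
    ring
  have hmonic : q.Monic := Polynomial.monic_X_pow_add_C c two_ne_zero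
  have hdegq : q.natDegree = 2 := Polynomial.natDegree_X_pow_add_C
  rw [← map_dvd_iff (finSuccEquiv ℝ n), hqN, ← Polynomial.modByMonic_eq_zero_iff_dvd hmonic]
  set p := finSuccEquiv ℝ n F with hp
  have hdeg : (p %ₘ q).natDegree ≤ 1 := by
    have := Polynomial.natDegree_modByMonic_lt p hmonic (fun h1 => by simp [h1] at hdegq)
    omega
  obtain ⟨a, b, hab⟩ := Polynomial.exists_eq_X_add_C_of_natDegree_le_one hdeg
  have key : ∀ y : Fin n → ℝ, ∀ r : ℝ, r ^ 2 + ∑ i, y i ^ 2 = 1 →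
      MvPolynomial.eval y a * r + MvPolynomial.eval y b = 0 := by
    intro y r hr
    have h0 := h (Fin.cons r y) (by simpa [Fin.sum_univ_succ] using hr)
    have hcy : r ^ 2 + MvPolynomial.eval y c = 0 := by
      simp only [hc, map_sub, map_sum, map_pow, MvPolynomial.eval_X, map_one]
      linarith
    rw [eval_eq_eval_mv_eval', ← hp, ← Polynomial.modByMonic_add_div p q, hab] at h0
    simpa [hq, hcy] using h0
  have hinf : ∀ _ : Fin n, (Set.Ioo (0 : ℝ) (1 / (n + 1))).Infinite :=
    fun _ => Set.Ioo_infinite (by positivity)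
  have hball : ∀ y ∈ Set.pi Set.univ (fun _ : Fin n => Set.Ioo (0 : ℝ) (1 / (n + 1))),
      MvPolynomial.eval y a = 0 ∧ MvPolynomial.eval y b = 0 := by
    intro y hy
    have hsum : ∑ i, y i ^ 2 < 1 := by
      have hle : ∑ i, y i ^ 2 ≤ ∑ _i : Fin n, (1 / (n + 1) : ℝ) := by
        refine Finset.sum_le_sum fun i _ => ?_
        obtain ⟨h1, h2⟩ := hy i trivial
        have h3 : (1 / (n + 1) : ℝ) ≤ 1 := by
          rw [div_le_one (by positivity)]
          simp
        nlinarith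
      refine hle.trans_lt ?_
      rw [Finset.sum_const, Finset.card_univ, Fintype.card_fin, nsmul_eq_mul, mul_one_div,
        div_lt_one (by positivity)]
      simp
    have hr : Real.sqrt (1 - ∑ i, y i ^ 2) ^ 2 = 1 - ∑ i, y i ^ 2 :=
      Real.sq_sqrt (by linarith)
    have hpos : 0 < Real.sqrt (1 - ∑ i, y i ^ 2) := Real.sqrt_pos.2 (by linarith)
    have h1 := key y _ (by rw [hr]; ring)
    have h2 := key y (-Real.sqrt (1 - ∑ i, y i ^ 2)) (by rw [neg_sq, hr]; ring)
    have hb : MvPolynomial.eval y b = 0 := by linarith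
    rw [hb, add_zero] at h1
    exact ⟨(mul_eq_zero.1 h1).resolve_right hpos.ne', hb⟩
  have ha : a = 0 := MvPolynomial.funext_set _ hinf fun y hy => by simpa using (hball y hy).1
  have hb : b = 0 := MvPolynomial.funext_set _ hinf fun y hy => by simpa using (hball y hy).2
  rw [hab, ha, hb]
  simp

/-- If `X` is a nonempty finite spherical `t`-design on the unit sphere of
`ℝ^m` and `F` is a real polynomial of total degree at most `t/2` vanishing on `X`, then
`Nm = Y₁² + ⋯ + Y_m² − 1` divides `F`. -/
theorem statement5 (m t : ℕ) (X : Finset (EuclideanSpace ℝ (Fin m)))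
    (hne : X.Nonempty)
    (hX : ∀ x ∈ X, x ∈ Metric.sphere (0 : EuclideanSpace ℝ (Fin m)) 1)
    (hdesign : ∀ G : MvPolynomial (Fin m) ℝ, G.totalDegree ≤ t →
      (X.card : ℝ)⁻¹ * ∑ x ∈ X, MvPolynomial.eval (fun i => x i) G =
        ∫ y, MvPolynomial.eval (fun i => (y : EuclideanSpace ℝ (Fin m)) i) G
          ∂(sphereUniform m))
    (F : MvPolynomial (Fin m) ℝ)
    (hvan : ∀ x ∈ X, MvPolynomial.eval (fun i => x i) F = 0)
    (hdeg : 2 * F.totalDegree ≤ t) :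
    ((∑ i : Fin m, MvPolynomial.X i ^ 2) - 1) ∣ F := by
  have hsq : ∫ y, MvPolynomial.eval (fun i => (y : EuclideanSpace ℝ (Fin m)) i) (F ^ 2)
      ∂(sphereUniform m) = 0 := by
    rw [← hdesign (F ^ 2) ((totalDegree_pow F 2).trans hdeg),
      Finset.sum_eq_zero fun x hx => by simp [hvan x hx], mul_zero]
  have hF := eval_eq_zero_of_integral_sq_eq_zero F hsq
  cases m with
  | zero =>
    obtain ⟨x, hx⟩ := hne
    have := hX x hx
    simp [Subsingleton.elim x 0] at this
  | succ n =>
    refine sum_X_sq_sub_one_dvd_of_eval_eq_zero F fun y hy => ?_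
    refine hF ⟨WithLp.toLp 2 y, ?_⟩
    simp [EuclideanSpace.norm_eq, hy]
end

section
/- With C an invertible real m×m matrix, d ∈ ℝ^m, 1 ≤ k ≤ m, ι the associated affine map, F_1, …, F_n ∈ ℂ[Y_1, …, Y_m], and G_i(Y') = F_i(ι(Y')): if p ∈ ℂ^k is such that q = ι(p) is a common zero of F_1, …, F_n and the n×m Jacobian matrix (∂F_i/∂Y_j)(q) has rank m, then p is a common zero of G_1, …, G_n and the n×k Jacobian matrix (∂G_i/∂Y'_j)(p) has rank k (i.e., simple zeros of ⟨F_1,…,F_n⟩ lying on the image of ι pull back to simple zeros of ⟨G_1,…,G_n⟩). -/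
open MvPolynomial

/-- The chain rule for partial derivatives of a composition of polynomials. -/
theorem MvPolynomial.pderiv_bind₁ {R σ τ : Type*} [CommSemiring R] [Fintype σ]
    (f : σ → MvPolynomial τ R) (P : MvPolynomial σ R) (j : τ) :
    pderiv j (bind₁ f P) = ∑ l, bind₁ f (pderiv l P) * pderiv j (f l) := by
  classical
  induction P using MvPolynomial.induction_on with
  | C a => simp
  | add p q hp hq => simp [hp, hq, add_mul, Finset.sum_add_distrib]
  | mul_X p i hp =>
    simp only [map_mul, bind₁_X_right, pderiv_mul, hp, map_add, add_mul, Finset.sum_add_distrib,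
      pderiv_X, Finset.sum_mul]
    congr 1
    · exact Finset.sum_congr rfl fun l _ => by ring
    · rw [Finset.sum_eq_single i]
      · simp
      · intro l _ hl
        simp [Pi.single_eq_of_ne hl.symm]
      · simp

/-- A matrix over a field has full column rank iff its columns are linearly independent. -/
theorem Matrix.rank_eq_card_iff_linearIndependent_col {K m n : Type*} [Field K] [Fintype n]
    (A : Matrix m n K) : A.rank = Fintype.card n ↔ LinearIndependent K A.col := by
  rw [linearIndependent_iff_card_eq_finrank_span, Set.finrank, ← A.rank_eq_finrank_span_cols,
    eq_comm]

/-- Full column rank is inherited by any selection of distinct columns. -/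
theorem Matrix.rank_submatrix_of_injective {K m n n₀ : Type*} [Field K] [Fintype n] [Fintype n₀]
    {A : Matrix m n K} (hA : A.rank = Fintype.card n) {e : n₀ → n} (he : Function.Injective e) :
    (A.submatrix id e).rank = Fintype.card n₀ :=
  (rank_eq_card_iff_linearIndependent_col _).2
    (((rank_eq_card_iff_linearIndependent_col _).1 hA).comp e he)

/-- Summing over `Fin m` against a vector of length `k ≤ m` padded by zeros. -/
theorem Fin.sum_mul_dite_lt {R : Type*} [NonUnitalNonAssocSemiring R] {m k : ℕ} (hkm : k ≤ m)
    (a : Fin m → R) (y : Fin k → R) :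
    (∑ i : Fin m, a i * (if h : (i : ℕ) < k then y ⟨i, h⟩ else 0)) =
      ∑ i : Fin k, a (Fin.castLE hkm i) * y i := by
  refine (Finset.sum_of_injOn (Fin.castLE hkm) (Fin.castLE_injective hkm).injOn (by simp) ?_
    fun i _ => ?_).symm
  · intro i _ hi
    have hik : ¬ (i : ℕ) < k := fun h => hi ⟨⟨i, h⟩, by simp, rfl⟩
    simp [hik]
  · simp

/-- Let `ι : ℂ^k → ℂ^m` be the affine map `ι(y) = C·(y,0) + d` with `C` an
invertible real matrix and `d ∈ ℝ^m`, and let `G_i(Y') = F_i(ι(Y'))`.  If `q = ι(p)` is a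
common zero of the `F_i` at which the Jacobian `(∂F_i/∂Y_j)(q)` has rank `m`, then `p` is a
common zero of the `G_i` at which the Jacobian `(∂G_i/∂Y'_j)(p)` has rank `k`. -/
theorem statement7 (m k n : ℕ) (hk1 : 1 ≤ k) (hkm : k ≤ m)
    (C : Matrix (Fin m) (Fin m) ℝ) (hC : IsUnit C.det) (d : Fin m → ℝ)
    (ι : (Fin k → ℂ) → (Fin m → ℂ))
    (hι : ∀ (y : Fin k → ℂ) (j : Fin m),
      ι y j = (∑ i : Fin m, (C j i : ℂ) * (if h : (i : ℕ) < k then y ⟨i, h⟩ else 0))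
        + (d j : ℂ))
    (F : Fin n → MvPolynomial (Fin m) ℂ) (G : Fin n → MvPolynomial (Fin k) ℂ)
    (hG : ∀ (i : Fin n) (p : Fin k → ℂ),
      MvPolynomial.eval p (G i) = MvPolynomial.eval (ι p) (F i))
    (p : Fin k → ℂ)
    (hzero : ∀ i : Fin n, MvPolynomial.eval (ι p) (F i) = 0)
    (hrank : (Matrix.of fun (i : Fin n) (j : Fin m) =>
      MvPolynomial.eval (ι p) (MvPolynomial.pderiv j (F i))).rank = m) :
    (∀ i : Fin n, MvPolynomial.eval p (G i) = 0) ∧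
      (Matrix.of fun (i : Fin n) (j : Fin k) =>
        MvPolynomial.eval p (MvPolynomial.pderiv j (G i))).rank = k := by
  classical
  refine ⟨fun i => by rw [hG, hzero], ?_⟩
  let L : Fin m → MvPolynomial (Fin k) ℂ := fun j =>
    (∑ i : Fin k, MvPolynomial.C (C j (Fin.castLE hkm i) : ℂ) * X i) + MvPolynomial.C (d j : ℂ)
  have hL : ∀ y : Fin k → ℂ, (fun j => eval y (L j)) = ι y := by
    intro y
    funext j
    rw [hι, Fin.sum_mul_dite_lt hkm (fun i => (C j i : ℂ)) y]
    simp [L]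
  have heval : ∀ (y : Fin k → ℂ) (P : MvPolynomial (Fin m) ℂ),
      eval y (bind₁ L P) = eval (ι y) P := by
    intro y P
    rw [← hL y]
    exact eval₂Hom_bind₁ _ _ _ _
  have hGL : ∀ i, G i = bind₁ L (F i) := fun i =>
    MvPolynomial.funext fun y => by rw [hG, heval]
  have hdL : ∀ (l : Fin m) (j : Fin k),
      pderiv j (L l) = MvPolynomial.C (C l (Fin.castLE hkm j) : ℂ) := by
    intro l j
    simp [L, pderiv_X, Pi.single_apply]
  set J : Matrix (Fin n) (Fin m) ℂ :=
    Matrix.of fun i j => eval (ι p) (pderiv j (F i)) with hJ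
  set C' : Matrix (Fin m) (Fin m) ℂ := C.map Complex.ofRealHom with hC'
  have hdet : IsUnit C'.det := by
    rw [hC', ← RingHom.mapMatrix_apply, ← RingHom.map_det]
    exact hC.map _
  have hjac : (Matrix.of fun (i : Fin n) (j : Fin k) => eval p (pderiv j (G i))) =
      (J * C').submatrix id (Fin.castLE hkm) := by
    ext i j
    simp [hGL, pderiv_bind₁, heval, hdL, hJ, hC', Matrix.mul_apply]
  have hfull : (J * C').rank = Fintype.card (Fin m) := by
    rw [Matrix.rank_mul_eq_left_of_isUnit_det _ _ hdet, hrank, Fintype.card_fin]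
  rw [hjac, Matrix.rank_submatrix_of_injective hfull (Fin.castLE_injective hkm),
    Fintype.card_fin]
end

section
/- Every polynomial F ∈ ℂ[Y_1, …, Y_8] of total degree at most 3 that vanishes at every point of E8 is divisible by Nm; moreover, there exists a polynomial of total degree 4 vanishing at every point of E8 that is not divisible by Nm. (Thus the smallest degree of a non-trivial polynomial in I(E8) is four.) -/
open MvPolynomial

/-- The 240 shortest vectors of the `E₈` root lattice: the vectors `±eᵢ ± eⱼ` (`i < j`)
together with the vectors `(±1/2, …, ±1/2)` with an even number of minus signs. -/
def E8 : Set (Fin 8 → ℝ) :=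
  {v | (∃ i j : Fin 8, i < j ∧ (v i = 1 ∨ v i = -1) ∧ (v j = 1 ∨ v j = -1) ∧
          ∀ l, l ≠ i → l ≠ j → v l = 0) ∨
    ((∀ i, v i = 1 / 2 ∨ v i = -(1 / 2)) ∧
      Even (Finset.univ.filter (fun i => v i = -(1 / 2 : ℝ))).card)}

/-- A real point viewed inside `ℂ^8`. -/
def cx8 : (Fin 8 → ℝ) → (Fin 8 → ℂ) := fun v i => (v i : ℂ)

/-- `Nm = Y₁² + ⋯ + Y₈² − 2`. -/
noncomputable def Nm8 : MvPolynomial (Fin 8) ℂ :=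
  (∑ i : Fin 8, MvPolynomial.X i ^ 2) - MvPolynomial.C 2

/-- The entrywise reduction modulo `2` of an exponent vector. -/
noncomputable def parity {σ : Type*} (m : σ →₀ ℕ) : σ →₀ ℕ :=
  m.mapRange (· % 2) rfl

theorem parity_eq_parity_iff {σ : Type*} (m n : σ →₀ ℕ) :
    parity m = parity n ↔ ∀ l, Even (m l + n l) := by
  simp only [parity, Finsupp.ext_iff, Finsupp.mapRange_apply, Nat.even_iff]
  exact forall_congr' fun l => by omega

/-- The sum of the terms of `F` whose exponent vectors reduce to `A` modulo `2`. -/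
noncomputable def parityPart {σ : Type*} [DecidableEq σ] (A : σ →₀ ℕ)
    (F : MvPolynomial σ ℂ) : MvPolynomial σ ℂ :=
  ∑ m ∈ F.support with parity m = A, monomial m (coeff m F)

theorem sum_parityPart {σ : Type*} [DecidableEq σ] (F : MvPolynomial σ ℂ) :
    ∑ A ∈ F.support.image parity, parityPart A F = F := by
  conv_rhs => rw [F.as_sum]
  exact Finset.sum_fiberwise_of_maps_to (fun m hm => Finset.mem_image_of_mem _ hm) _

theorem coeff_parityPart {σ : Type*} [DecidableEq σ] (A n : σ →₀ ℕ) (F : MvPolynomial σ ℂ) :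
    coeff n (parityPart A F) = if parity n = A then coeff n F else 0 := by
  simp only [parityPart, coeff_sum, coeff_monomial, Finset.sum_ite_eq', Finset.mem_filter,
    mem_support_iff]
  split_ifs <;> simp_all

theorem sum_units_prod_pow {σ : Type*} [Fintype σ] [DecidableEq σ] (n : σ → ℕ) :
    ∑ s : σ → ℤˣ, ∏ l, (((s l : ℤ) : ℂ)) ^ n l =
      if ∀ l, Even (n l) then (2 : ℂ) ^ Fintype.card σ else 0 := by
  have hu (k : ℕ) : ∑ u : ℤˣ, ((u : ℤ) : ℂ) ^ k = if Even k then 2 else 0 := by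
    have : (Finset.univ : Finset ℤˣ) = {1, -1} := by decide
    rw [this, Finset.sum_pair (by decide)]
    split_ifs with h
    · simp [h.neg_one_pow]; norm_num
    · simp [(Nat.not_even_iff_odd.mp h).neg_one_pow]
  have := Finset.prod_univ_sum (fun _ : σ => (Finset.univ : Finset ℤˣ))
    (fun l u => ((u : ℤ) : ℂ) ^ n l)
  rw [Fintype.piFinset_univ] at this
  rw [← this]
  simp only [hu, Finset.prod_ite_zero, Finset.mem_univ, true_implies, Finset.prod_const,
    Finset.card_univ]

theorem eval_parityPart_eq_zero {σ : Type*} [Fintype σ] [DecidableEq σ] (A : σ →₀ ℕ)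
    (hA : parity A = A) (F : MvPolynomial σ ℂ) (hdeg : A.degree + F.totalDegree < Fintype.card σ) (r : σ → ℂ)
    (h : ∀ s : σ → ℤˣ, ∏ l, s l = 1 → eval (fun l => ((s l : ℤ) : ℂ) * r l) F = 0) :
    eval r (parityPart A F) = 0 := by
  have hzero : ∑ s : σ → ℤˣ, (1 + ∏ l, ((s l : ℤ) : ℂ)) * (∏ l, ((s l : ℤ) : ℂ) ^ A l) *
      eval (fun l => ((s l : ℤ) : ℂ) * r l) F = 0 := by
    refine Finset.sum_eq_zero fun s _ => ?_
    rcases Int.units_eq_one_or (∏ l, s l) with hs | hs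
    · rw [h s hs, mul_zero]
    · have : ∏ l, ((s l : ℤ) : ℂ) = -1 := by
        have := congrArg (fun u : ℤˣ => ((u : ℤ) : ℂ)) hs
        simpa using this
      rw [this]; simp
  have hterm (s : σ → ℤˣ) : (1 + ∏ l, ((s l : ℤ) : ℂ)) * (∏ l, ((s l : ℤ) : ℂ) ^ A l) *
      eval (fun l => ((s l : ℤ) : ℂ) * r l) F =
      ∑ m ∈ F.support, coeff m F * (∏ l, r l ^ m l) *
        (∏ l, ((s l : ℤ) : ℂ) ^ (A l + m l) + ∏ l, ((s l : ℤ) : ℂ) ^ (A l + m l + 1)) := by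
    rw [eval_eq', Finset.mul_sum]
    refine Finset.sum_congr rfl fun m _ => ?_
    simp only [pow_add, mul_pow, Finset.prod_mul_distrib, pow_one]
    ring
  simp only [hterm] at hzero
  rw [Finset.sum_comm] at hzero
  simp only [← Finset.mul_sum, Finset.sum_add_distrib, sum_units_prod_pow] at hzero
  have hodd (m) (hm : m ∈ F.support) : ¬ ∀ l, Even (A l + m l + 1) := by
    intro he
    have h1 : ∑ _l : σ, 1 ≤ ∑ l, (A l + m l) := Finset.sum_le_sum fun l _ => by
      have := he l
      rw [Nat.even_iff] at this
      omega
    rw [Finset.sum_add_distrib, ← Finsupp.degree_eq_sum, ← Finsupp.degree_eq_sum] at h1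
    have h2 : m.degree ≤ F.totalDegree := le_totalDegree hm
    simp at h1
    omega
  have hsum : eval r (parityPart A F) * 2 ^ Fintype.card σ = 0 := by
    rw [← hzero, parityPart, map_sum, Finset.sum_filter, Finset.sum_mul]
    refine Finset.sum_congr rfl fun m hm => ?_
    rw [if_neg (hodd m hm), add_zero]
    have : parity m = A ↔ ∀ l, Even (A l + m l) := by
      rw [← parity_eq_parity_iff, hA, eq_comm]
    simp only [this, eval_monomial, Finsupp.prod_fintype _ _ (fun i => pow_zero (r i))]
    split_ifs <;> simp
  simpa using hsum

theorem exists_eq_parity_add {σ : Type*} (m : σ →₀ ℕ) (hm : m.degree ≤ 3) :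
    m = parity m ∨ ∃ j, m = parity m + Finsupp.single j 2 := by
  classical
  by_cases h : ∃ j, 2 ≤ m j
  · right
    obtain ⟨j, hj⟩ := h
    refine ⟨j, ?_⟩
    obtain ⟨n, rfl⟩ : ∃ n, m = n + Finsupp.single j 2 := by
      refine ⟨m - Finsupp.single j 2, (tsub_add_cancel_of_le ?_).symm⟩
      simpa using hj
    have hn : n.degree ≤ 1 := by
      simp only [map_add, Finsupp.degree_single] at hm
      omega
    congr 1
    ext l
    have hl := (Finsupp.le_degree l n).trans hn
    by_cases hlj : j = l <;> simp [parity, hlj] <;> omega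
  · left
    push Not at h
    ext l
    have := h l
    simp only [parity, Finsupp.mapRange_apply]
    omega

theorem parity_add_single_two {σ : Type*} (A : σ →₀ ℕ) (j : σ) :
    parity (A + Finsupp.single j 2) = parity A := by
  classical
  rw [parity_eq_parity_iff]
  intro l
  by_cases h : j = l <;> simp [h, Nat.even_add]

theorem parityPart_eq {σ : Type*} [Fintype σ] [DecidableEq σ] (A : σ →₀ ℕ)
    (hA : parity A = A) (F : MvPolynomial σ ℂ) (hF : F.totalDegree ≤ 3) :
    parityPart A F = monomial A 1 * (C (coeff A F) +
      ∑ j, C (coeff (A + Finsupp.single j 2) F) * X j ^ 2) := by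
  have hrhs : monomial A 1 * (C (coeff A F) +
      ∑ j, C (coeff (A + Finsupp.single j 2) F) * X j ^ 2) =
      monomial A (coeff A F) + ∑ j, monomial (A + Finsupp.single j 2)
        (coeff (A + Finsupp.single j 2) F) := by
    simp [mul_add, Finset.mul_sum, X_pow_eq_monomial, C_mul_monomial, monomial_mul,
      mul_comm _ (C _)]
  rw [hrhs]
  ext n
  simp only [coeff_parityPart, coeff_add, coeff_sum, coeff_monomial]
  by_cases hdeg : n.degree ≤ 3
  swap
  · have h0 : coeff n F = 0 := by
      by_contra hne
      exact hdeg ((le_totalDegree (mem_support_iff.mpr hne)).trans hF)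
    rw [h0, ite_self]
    symm
    refine (congrArg₂ (· + ·) ?_ (Finset.sum_eq_zero fun j _ => ?_)).trans (add_zero 0)
    all_goals
      split_ifs with h
      · rw [h, h0]
      · rfl
  have hne (j) : A + Finsupp.single j 2 ≠ A := by simp
  have hinj (j k) : A + Finsupp.single j 2 = A + Finsupp.single k 2 ↔ j = k := by
    simp [Finsupp.single_left_inj]
  split_ifs with hp h h
  · subst h
    simp [hne]
  · rcases exists_eq_parity_add n hdeg with h' | ⟨j, h'⟩
    · exact absurd (hp ▸ h').symm h
    · rw [hp] at h'
      subst h'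
      simp [hinj]
  · exact absurd (h ▸ hA) hp
  · symm
    rw [zero_add]
    refine Finset.sum_eq_zero fun j _ => if_neg fun h' => hp ?_
    rw [← h', parity_add_single_two, hA]

theorem half_signs_mem_E8 (s : Fin 8 → ℤˣ) (hs : ∏ l, s l = 1) :
    (fun l => ((s l : ℤ) : ℝ) * (1 / 2)) ∈ E8 := by
  refine Or.inr ⟨fun i => ?_, ?_⟩
  · rcases Int.units_eq_one_or (s i) with h | h <;> simp [h]
  · have hiff (i) : ((s i : ℤ) : ℝ) * (1 / 2) = -(1 / 2) ↔ s i = -1 := by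
      rcases Int.units_eq_one_or (s i) with h | h
      · rw [h]; norm_num
      · rw [h]; norm_num
    simp only [hiff]
    have hs' (i) : s i = if s i = -1 then -1 else 1 := by
      rcases Int.units_eq_one_or (s i) with h | h <;> rw [h] <;> decide
    rw [Finset.prod_congr rfl fun i _ => hs' i, Finset.prod_ite, Finset.prod_const,
      Finset.prod_const_one, mul_one] at hs
    exact (neg_one_pow_eq_one_iff_even (by decide)).mp hs

theorem signs_mul_pair_mem_E8 (s : Fin 8 → ℤˣ) {i j : Fin 8} (hij : i ≠ j) :
    (fun l => ((s l : ℤ) : ℝ) * (if l = i ∨ l = j then 1 else 0)) ∈ E8 := by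
  wlog h : i < j generalizing i j
  · simpa only [or_comm] using this hij.symm (lt_of_le_of_ne (not_lt.mp h) hij.symm)
  refine Or.inl ⟨i, j, h, ?_, ?_, fun l hi hj => by simp [hi, hj]⟩
  · rcases Int.units_eq_one_or (s i) with h | h <;> simp [h]
  · rcases Int.units_eq_one_or (s j) with h | h <;> simp [h]

theorem eq_of_pair_sums {b : Fin 8 → ℂ} {c : ℂ} (i : Fin 8)
    (hpair : ∀ j, j ≠ i → c + (b i + b j) = 0) (hsum : c + (∑ j, b j) * (1 / 4) = 0) (j : Fin 8) :
    b j = -c / 2 := by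
  have hb (j) (hj : j ∈ Finset.univ.erase i) : b j = -c - b i := by
    linear_combination hpair j (Finset.ne_of_mem_erase hj)
  have hi : b i = -c / 2 := by
    rw [← Finset.add_sum_erase _ _ (Finset.mem_univ i), Finset.sum_congr rfl hb,
      Finset.sum_const, Finset.card_erase_of_mem (Finset.mem_univ i)] at hsum
    simp at hsum
    linear_combination (-2 / 3) * hsum
  by_cases hj : j = i
  · rw [hj, hi]
  · linear_combination hpair j hj - hi

theorem Nm8_dvd_parityPart (F : MvPolynomial (Fin 8) ℂ) (hF : F.totalDegree ≤ 3)
    (h : ∀ a ∈ E8, eval (cx8 a) F = 0) (A : Fin 8 →₀ ℕ) (hA : parity A = A) (hA3 : A.degree ≤ 3) :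
    Nm8 ∣ parityPart A F := by
  have hdeg : A.degree + F.totalDegree < Fintype.card (Fin 8) := by
    simp only [Fintype.card_fin]; omega
  set b : Fin 8 → ℂ := fun j => coeff (A + Finsupp.single j 2) F
  set c : ℂ := coeff A F
  have heval (r : Fin 8 → ℝ) (hr : ∀ s : Fin 8 → ℤˣ, ∏ l, s l = 1 →
      (fun l => ((s l : ℤ) : ℝ) * r l) ∈ E8) (hr0 : ∀ l, A l ≠ 0 → r l ≠ 0) :
      c + ∑ j, b j * (r j : ℂ) ^ 2 = 0 := by
    have h0 := eval_parityPart_eq_zero A hA F hdeg (cx8 r) fun s hs => by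
      have := h _ (hr s hs)
      unfold cx8 at this ⊢
      exact_mod_cast this
    rw [parityPart_eq A hA F hF] at h0
    simp only [map_mul, map_add, map_sum, map_pow, eval_C, eval_X, eval_monomial, one_mul,
      mul_eq_zero] at h0
    refine h0.resolve_left ?_
    refine Finset.prod_ne_zero_iff.mpr fun l hl => pow_ne_zero _ ?_
    simpa [cx8] using hr0 l (Finsupp.mem_support_iff.mp hl)
  have hhalf : c + (∑ j, b j) * (1 / 4) = 0 := by
    rw [← heval (fun _ => 1 / 2) half_signs_mem_E8 (by norm_num), Finset.sum_mul]
    norm_num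
  have hbj : ∀ j, b j = -c / 2 := by
    by_cases hA1 : A.degree ≤ 1
    · obtain ⟨i, hi⟩ : ∃ i, ∀ l, A l ≠ 0 → l = i := by
        rcases Nat.le_one_iff_eq_zero_or_eq_one.mp hA1 with h0 | h1
        · rw [Finsupp.degree_eq_zero_iff] at h0
          exact ⟨0, by simp [h0]⟩
        · obtain ⟨i, rfl⟩ := (Finsupp.sum_eq_one_iff A).mp h1
          exact ⟨i, fun l hl => by
            by_contra hne
            simp [Ne.symm hne] at hl⟩
      refine eq_of_pair_sums i (fun j hj => ?_) hhalf
      rw [← heval _ (fun s _ => signs_mul_pair_mem_E8 s hj.symm) fun l hl => by simp [hi l hl]]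
      congr 1
      have hsq (l) : b l * (((if l = i ∨ l = j then 1 else 0 : ℝ)) : ℂ) ^ 2 =
          (if l = i then b l else 0) + if l = j then b l else 0 := by
        by_cases h1 : l = i
        · simp [h1, hj.symm]
        · by_cases h2 : l = j <;> simp [h1, h2, hj]
      simp [hsq, Finset.sum_add_distrib]
    · have hb0 (j) : b j = 0 := by
        by_contra hne
        have h2 : (A + Finsupp.single j 2).degree ≤ F.totalDegree :=
          le_totalDegree (mem_support_iff.mpr hne)
        simp only [map_add, Finsupp.degree_single] at h2
        omega
      simp only [hb0, Finset.sum_const_zero, zero_mul, add_zero] at hhalf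
      simp [hb0, hhalf]
  rw [parityPart_eq A hA F hF]
  refine Dvd.dvd.mul_left ⟨C (-c / 2), ?_⟩ _
  change C c + ∑ j, C (b j) * X j ^ 2 = _
  simp only [hbj, Nm8]
  have hc2 : (C c : MvPolynomial (Fin 8) ℂ) = -(C 2 * C (-c / 2)) := by
    rw [← C_mul, ← C_neg]
    congr 1
    ring
  rw [← Finset.mul_sum, hc2]
  ring

theorem Nm8_dvd_of_totalDegree_le_three (F : MvPolynomial (Fin 8) ℂ) (hF : F.totalDegree ≤ 3)
    (h : ∀ a ∈ E8, eval (cx8 a) F = 0) : Nm8 ∣ F := by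
  rw [← sum_parityPart F]
  refine Finset.dvd_sum fun A hA => ?_
  obtain ⟨m, hm, rfl⟩ := Finset.mem_image.mp hA
  refine Nm8_dvd_parityPart F hF h _ ?_ ?_
  · ext l
    simp [parity]
  · have h2 : m.degree ≤ F.totalDegree := le_totalDegree hm
    have h3 : (parity m).degree ≤ m.degree := by
      simp only [Finsupp.degree_eq_sum]
      exact Finset.sum_le_sum fun l _ => Nat.mod_le _ _
    omega

/-- The quartic `Y₁Y₂(Y₃² − Y₄²)`. -/
noncomputable def quarticE8 : MvPolynomial (Fin 8) ℂ :=
  X 0 * X 1 * (X 2 ^ 2 - X 3 ^ 2)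

theorem not_Nm8_dvd_quarticE8 : ¬ Nm8 ∣ quarticE8 := by
  rintro ⟨Q, hQ⟩
  have := congrArg (eval ![1, 1, 1, 0, Complex.I, 0, 0, 0]) hQ
  simp [quarticE8, Nm8, Fin.sum_univ_succ] at this
  norm_num at this

theorem totalDegree_quarticE8 : quarticE8.totalDegree = 4 := by
  have h : quarticE8.IsHomogeneous 4 :=
    ((isHomogeneous_X ℂ 0).mul (isHomogeneous_X ℂ 1)).mul
      ((isHomogeneous_X_pow 2 2).sub (isHomogeneous_X_pow 3 2))
  refine h.totalDegree fun h0 => not_Nm8_dvd_quarticE8 ?_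
  rw [h0]
  exact dvd_zero _

theorem eval_quarticE8 (a : Fin 8 → ℝ) (ha : a ∈ E8) : eval (cx8 a) quarticE8 = 0 := by
  have key : a 0 * a 1 * (a 2 ^ 2 - a 3 ^ 2) = 0 := by
    rcases ha with ⟨i, j, hij, -, -, h⟩ | ⟨h, -⟩
    · by_cases h0 : 0 ≠ i ∧ 0 ≠ j
      · simp [h 0 h0.1 h0.2]
      by_cases h1 : 1 ≠ i ∧ 1 ≠ j
      · simp [h 1 h1.1 h1.2]
      have h2 := h 2 (by omega) (by omega)
      have h3 := h 3 (by omega) (by omega)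
      simp [h2, h3]
    · have hsq (l) : a l ^ 2 = 1 / 4 := by
        rcases h l with h | h <;> rw [h] <;> norm_num
      simp [hsq]
  simp only [quarticE8, cx8, map_mul, map_sub, map_pow, eval_X]
  exact_mod_cast key

/-- Every `F ∈ ℂ[Y₁,…,Y₈]` of total degree at most `3` vanishing on `E8`
is divisible by `Nm`, and some polynomial of total degree `4` vanishing on `E8` is not
divisible by `Nm`. -/
theorem statement11 :
    (∀ F : MvPolynomial (Fin 8) ℂ, F.totalDegree ≤ 3 →
      (∀ a ∈ E8, MvPolynomial.eval (cx8 a) F = 0) → Nm8 ∣ F) ∧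
    ∃ F : MvPolynomial (Fin 8) ℂ, F.totalDegree = 4 ∧
      (∀ a ∈ E8, MvPolynomial.eval (cx8 a) F = 0) ∧ ¬ Nm8 ∣ F := by
  exact ⟨Nm8_dvd_of_totalDegree_le_three, quarticE8, totalDegree_quarticE8, eval_quarticE8,
    not_Nm8_dvd_quarticE8⟩
end

section
/- Every polynomial F ∈ ℂ[Y_1, …, Y_24] of total degree at most 5 that vanishes at every point of L24 is divisible by Nm; moreover, there exists a polynomial of total degree 6 vanishing at every point of L24 that is not divisible by Nm. (Thus the smallest degree of a non-trivial polynomial in I(L24) is six.) -/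
open MvPolynomial

/-- The edges of the icosahedron graph on the vertex set `{0, …, 11}` (a pentagonal
antiprism on `{1, …, 10}` together with the two apexes `0` and `11`). -/
def icosEdges : List (ℕ × ℕ) :=
  [(0, 1), (0, 2), (0, 3), (0, 4), (0, 5),
   (1, 2), (2, 3), (3, 4), (4, 5), (5, 1),
   (11, 6), (11, 7), (11, 8), (11, 9), (11, 10),
   (6, 7), (7, 8), (8, 9), (9, 10), (10, 6),
   (1, 6), (1, 7), (2, 7), (2, 8), (3, 8), (3, 9), (4, 9), (4, 10), (5, 10), (5, 6)]

/-- The adjacency matrix of the icosahedron graph, over `𝔽₂`. -/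
def icosA : Matrix (Fin 12) (Fin 12) (ZMod 2) :=
  Matrix.of fun i j =>
    if ((i : ℕ), (j : ℕ)) ∈ icosEdges ∨ ((j : ℕ), (i : ℕ)) ∈ icosEdges then 1 else 0

/-- The generator matrix `[ I | J − A ]` of the extended binary Golay code, where `A` is
the adjacency matrix of the icosahedron and `J` is the all-ones matrix. -/
def golayGen : Matrix (Fin 12) (Fin 24) (ZMod 2) :=
  Matrix.of fun i j =>
    if h : (j : ℕ) < 12 then (if (i : ℕ) = (j : ℕ) then 1 else 0)
    else 1 - icosA i ⟨(j : ℕ) - 12, by have := j.isLt; omega⟩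

/-- The extended binary Golay code: the row space over `𝔽₂` of `golayGen`. -/
def G24 : Set (Fin 24 → ZMod 2) :=
  {w | ∃ u : Fin 12 → ZMod 2, w = Matrix.vecMul u golayGen}

/-- The 196560 shortest vectors of the Leech lattice (scaled by `√8`): vectors of shape
`(±2⁸, 0¹⁶)` supported on a weight-8 Golay codeword with evenly many minus signs, of shape
`(∓3, ±1²³)` with the positions of the `−3` and the `+1`s forming the support of a Golay
codeword, and of shape `(±4², 0²²)`. -/
def L24 : Set (Fin 24 → ℝ) :=
  {v |
    (∃ c ∈ G24, (Finset.univ.filter fun i => c i ≠ 0).card = 8 ∧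
      (∀ i, c i ≠ 0 → v i = 2 ∨ v i = -2) ∧ (∀ i, c i = 0 → v i = 0) ∧
      Even (Finset.univ.filter fun i => v i = (-2 : ℝ)).card) ∨
    (∃ c ∈ G24, ∃ i₀ : Fin 24, (v i₀ = 3 ∨ v i₀ = -3) ∧
      (∀ i, i ≠ i₀ → v i = 1 ∨ v i = -1) ∧
      (∀ i, (v i = -3 ∨ v i = 1) ↔ c i ≠ 0)) ∨
    (∃ i j : Fin 24, i ≠ j ∧ (v i = 4 ∨ v i = -4) ∧ (v j = 4 ∨ v j = -4) ∧
      ∀ l, l ≠ i → l ≠ j → v l = 0)}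

/-- A real point viewed inside `ℂ^24`. -/
def cx24 : (Fin 24 → ℝ) → (Fin 24 → ℂ) := fun v i => (v i : ℂ)

/-- `Nm = Y₁² + ⋯ + Y₂₄² − 32`. -/
noncomputable def Nm24 : MvPolynomial (Fin 24) ℂ :=
  (∑ i : Fin 24, MvPolynomial.X i ^ 2) - MvPolynomial.C 32

/-- The indicator vector over `𝔽₂` of a set of coordinates. -/
def ind (S : Finset (Fin 24)) : Fin 24 → ZMod 2 := fun i => if i ∈ S then 1 else 0

lemma zmod_two_cases (x : ZMod 2) : x = 0 ∨ x = 1 := by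
  revert x; decide

lemma ind_support (c : Fin 24 → ZMod 2) : ind (Finset.univ.filter fun i => c i ≠ 0) = c := by
  funext i
  rcases zmod_two_cases (c i) with h | h <;> simp [ind, h]

lemma support_ind (S : Finset (Fin 24)) : (Finset.univ.filter fun i => ind S i ≠ 0) = S := by
  ext i; simp [ind]

lemma ind_add_ind (S T : Finset (Fin 24)) : ind S + ind T = ind (symmDiff S T) := by
  funext i
  by_cases hS : i ∈ S <;> by_cases hT : i ∈ T <;>
    simp [ind, hS, hT, Finset.mem_symmDiff, CharTwo.add_self_eq_zero]

/-! ### The Golay code -/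

lemma golayGen_mul_transpose : golayGen * golayGen.transpose = 0 := by
  decide +kernel

/-- Projection onto the information positions of the Golay code. -/
def golayProj : Matrix (Fin 12) (Fin 24) (ZMod 2) :=
  Matrix.of fun i j => if (i : ℕ) = (j : ℕ) then 1 else 0

/-- Correction matrix: vectors orthogonal to the code are recovered from their
information positions. -/
def golayCorr : Matrix (Fin 24) (Fin 12) (ZMod 2) :=
  Matrix.of fun i j => if (i : ℕ) < 12 then 0 else golayGen j i

lemma golayGen_transpose_mul_proj :
    golayGen.transpose * golayProj + golayCorr * golayGen = 1 := by
  decide +kernel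

lemma mem_G24_iff (c : Fin 24 → ZMod 2) : c ∈ G24 ↔ golayGen.mulVec c = 0 := by
  constructor
  · rintro ⟨u, rfl⟩
    rw [← Matrix.mulVec_transpose, Matrix.mulVec_mulVec, golayGen_mul_transpose,
      Matrix.zero_mulVec]
  · intro h
    refine ⟨golayProj.mulVec c, ?_⟩
    rw [← Matrix.mulVec_transpose, Matrix.mulVec_mulVec,
      ← add_zero ((golayGen.transpose * golayProj).mulVec c),
      ← Matrix.mulVec_zero golayCorr, ← h, Matrix.mulVec_mulVec, ← Matrix.add_mulVec,
      golayGen_transpose_mul_proj, Matrix.one_mulVec]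

lemma add_mem_G24 {c d : Fin 24 → ZMod 2} (hc : c ∈ G24) (hd : d ∈ G24) : c + d ∈ G24 := by
  rw [mem_G24_iff] at *
  rw [Matrix.mulVec_add, hc, hd, add_zero]

lemma dotProduct_eq_zero_of_mem_G24 {c d : Fin 24 → ZMod 2} (hc : c ∈ G24) (hd : d ∈ G24) :
    c ⬝ᵥ d = 0 := by
  obtain ⟨u, rfl⟩ := hc
  rw [← Matrix.dotProduct_mulVec, (mem_G24_iff d).1 hd, dotProduct_zero]

lemma ind_univ_mem_G24 : ind Finset.univ ∈ G24 := by
  rw [mem_G24_iff]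
  decide +kernel

lemma golayGen_row_mem_G24 (i : Fin 12) : golayGen i ∈ G24 :=
  ⟨Pi.single i 1, by rw [Matrix.single_one_vecMul]; rfl⟩

/-- The rows of the generator matrix as bit masks. -/
def golayMask : Fin 12 → ℕ :=
  ![16519169, 15835138, 15155204, 13541384, 10313744, 12238880,
    3526720, 7049344, 5714176, 3043840, 5829632, 8648704]

/-- The number of ones among the lowest `k` binary digits. -/
def bitWeight : ℕ → ℕ → ℕ
  | 0, _ => 0
  | k + 1, n => n % 2 + bitWeight k (n / 2)

/-- Whether a Boolean test succeeds on all sums (bitwise exclusive or) of a given bit mask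
and of the members of a sublist of a list of bit masks. -/
def testXorSums (p : ℕ → Bool) : List ℕ → ℕ → Bool
  | [], n => p n
  | r :: rs, n => testXorSums p rs n && testXorSums p rs (n ^^^ r)

lemma testBit_golayMask : ∀ (i : Fin 12) (j : Fin 24),
    (golayMask i).testBit j = decide (golayGen i j = 1) := by
  decide +kernel

lemma testXorSums_golayMask :
    testXorSums (fun n => decide (8 ≤ bitWeight 24 n ∨ bitWeight 24 n = 0))
      ((List.finRange 12).map golayMask) 0 = true := by
  decide +kernel

lemma bitWeight_eq_card (k n : ℕ) :
    bitWeight k n = (Finset.univ.filter fun j : Fin k => n.testBit j = true).card := by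
  induction k generalizing n with
  | zero => simp [bitWeight]
  | succ k ih =>
    rw [bitWeight, ih, Fin.card_filter_univ_succ]
    rcases Nat.mod_two_eq_zero_or_one n with h | h <;>
      simp [Nat.testBit_succ, Nat.testBit_zero, h]
    omega

lemma testXorSums_spec {p : ℕ → Bool} (l : List (Fin 12)) (n : ℕ)
    (h : testXorSums p (l.map golayMask) n = true) (u : Fin 12 → ZMod 2) :
    ∃ m, p m = true ∧ ∀ j : Fin 24, ((m.testBit j).toNat : ZMod 2) =
      (n.testBit j).toNat + (l.map fun i => u i * golayGen i j).sum := by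
  induction l generalizing n with
  | nil => exact ⟨n, h, by simp⟩
  | cons i l ih =>
    simp only [List.map_cons, testXorSums, Bool.and_eq_true] at h
    rcases zmod_two_cases (u i) with hu | hu
    · simpa [hu] using ih n h.1
    · obtain ⟨m, hm, hm'⟩ := ih _ h.2
      refine ⟨m, hm, fun j => ?_⟩
      rw [hm', List.map_cons, List.sum_cons, hu, one_mul, Nat.testBit_xor, testBit_golayMask,
        ← add_assoc]
      congr 1
      rcases zmod_two_cases (golayGen i j) with hg | hg <;> cases n.testBit j <;>
        simp [hg, CharTwo.add_self_eq_zero]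

lemma eight_le_card_of_mem_G24 {c : Fin 24 → ZMod 2} (hc : c ∈ G24) (h0 : c ≠ 0) :
    8 ≤ (Finset.univ.filter fun i => c i ≠ 0).card := by
  obtain ⟨u, rfl⟩ := hc
  obtain ⟨m, hm, hm'⟩ := testXorSums_spec _ _ testXorSums_golayMask u
  have key : ∀ j : Fin 24, m.testBit j = true ↔ Matrix.vecMul u golayGen j ≠ 0 := by
    intro j
    have h := hm' j
    rw [← List.ofFn_eq_map, List.sum_ofFn] at h
    change _ = _ + Matrix.vecMul u golayGen j at h
    rw [Nat.zero_testBit, Bool.toNat_false, Nat.cast_zero, zero_add] at h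
    rw [← h]
    cases m.testBit j <;> simp
  simp only [bitWeight_eq_card, key, decide_eq_true_eq] at hm
  refine hm.resolve_right fun h => h0 ?_
  rw [Finset.card_eq_zero, Finset.filter_eq_empty_iff] at h
  funext j
  simpa using h (Finset.mem_univ j)

lemma eight_le_card_of_ind_mem_G24 {S : Finset (Fin 24)} (hS : ind S ∈ G24) (h0 : S ≠ ∅) :
    8 ≤ S.card := by
  rw [← support_ind S]
  refine eight_le_card_of_mem_G24 hS fun h => h0 ?_
  rw [← support_ind S, h]
  simp

lemma eq_of_symmDiff_card_lt {S T : Finset (Fin 24)} (h : ind (symmDiff S T) ∈ G24)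
    (hc : S.card + T.card < 8) : S = T := by
  by_contra hne
  have h1 := eight_le_card_of_ind_mem_G24 h fun h => hne (symmDiff_eq_bot.1 h)
  have h2 : (symmDiff S T).card ≤ S.card + T.card :=
    (Finset.card_le_card (symmDiff_le_sup (a := S) (b := T))).trans (Finset.card_union_le _ _)
  omega

lemma ind_dotProduct_ind (S T : Finset (Fin 24)) : ind S ⬝ᵥ ind T = ((S ∩ T).card : ZMod 2) := by
  simp only [dotProduct, ind, ite_mul, one_mul, zero_mul, ← ite_and, ← Finset.mem_inter]
  simp [Finset.filter_and]

lemma even_card_inter {S T : Finset (Fin 24)} (hS : ind S ∈ G24) (hT : ind T ∈ G24) :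
    Even (S ∩ T).card := by
  rw [← ZMod.natCast_eq_zero_iff_even, ← ind_dotProduct_ind]
  exact dotProduct_eq_zero_of_mem_G24 hS hT

lemma card_symmDiff_add (S T : Finset (Fin 24)) :
    (symmDiff S T).card + 2 * (S ∩ T).card = S.card + T.card := by
  have h1 : (symmDiff S T).card = (S \ T).card + (T \ S).card := by
    rw [symmDiff_def]
    exact Finset.card_union_of_disjoint disjoint_sdiff_sdiff
  have h2 := Finset.card_sdiff_add_card_inter S T
  have h3 := Finset.card_sdiff_add_card_inter T S
  rw [Finset.inter_comm] at h3
  omega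

/-! ### The Steiner system of octads -/

/-- The octads of the Golay code containing a given set. -/
noncomputable def octads (S : Finset (Fin 24)) : Finset (Finset (Fin 24)) :=
  open Classical in Finset.univ.filter fun O => ind O ∈ G24 ∧ O.card = 8 ∧ S ⊆ O

lemma mem_octads {S O : Finset (Fin 24)} :
    O ∈ octads S ↔ ind O ∈ G24 ∧ O.card = 8 ∧ S ⊆ O := by
  simp [octads]

/-- The sets of one or three coordinates. -/
def smallOddSets : Finset (Finset (Fin 24)) :=
  Finset.powersetCard 1 Finset.univ ∪ Finset.powersetCard 3 Finset.univ

lemma mem_smallOddSets {S : Finset (Fin 24)} : S ∈ smallOddSets ↔ S.card = 1 ∨ S.card = 3 := by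
  simp [smallOddSets]

lemma card_smallOddSets : smallOddSets.card = 2048 := by
  rw [smallOddSets, Finset.card_union_of_disjoint
    (Finset.pairwise_disjoint_powersetCard _ (show 1 ≠ 3 by norm_num))]
  simp only [Finset.card_powersetCard, Finset.card_univ, Fintype.card_fin]
  decide

/-- The syndrome of a small odd set, possibly translated by a basis vector. -/
def smallSyndrome (x : smallOddSets × ZMod 2) : Fin 12 → ZMod 2 :=
  golayGen.mulVec (ind x.1 + x.2 • ind {0})

lemma odd_card_of_mem_smallOddSets {S : Finset (Fin 24)} (h : S ∈ smallOddSets) :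
    ((S.card : ℕ) : ZMod 2) = 1 := by
  rcases mem_smallOddSets.1 h with h | h <;> rw [h] <;> decide

lemma add_mem_G24_of_mulVec_eq {c d : Fin 24 → ZMod 2}
    (h : golayGen.mulVec c = golayGen.mulVec d) : c + d ∈ G24 := by
  rw [mem_G24_iff, Matrix.mulVec_add, h]
  exact CharTwo.add_self_eq_zero _

lemma dotProduct_ind_univ (S : Finset (Fin 24)) : ind S ⬝ᵥ ind Finset.univ = (S.card : ZMod 2) := by
  simp [ind_dotProduct_ind]

lemma smallSyndrome_injective : Function.Injective smallSyndrome := by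
  rintro ⟨⟨U, hU⟩, b⟩ ⟨⟨V, hV⟩, b'⟩ h
  have hmem := add_mem_G24_of_mulVec_eq h
  have hpar := dotProduct_eq_zero_of_mem_G24 hmem ind_univ_mem_G24
  simp only [add_dotProduct, smul_dotProduct, dotProduct_ind_univ,
    odd_card_of_mem_smallOddSets hU, odd_card_of_mem_smallOddSets hV] at hpar
  have hb : b = b' := by
    simp only [Finset.card_singleton] at hpar
    clear hmem h
    revert b b'
    decide
  subst hb
  have hUV : ind (symmDiff U V) ∈ G24 := by
    convert hmem using 1
    rw [← ind_add_ind, add_add_add_comm, CharTwo.add_self_eq_zero (b • ind {0}), add_zero]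
  have : U = V := by
    refine eq_of_symmDiff_card_lt hUV ?_
    rcases mem_smallOddSets.1 hU with h | h <;> rcases mem_smallOddSets.1 hV with h' | h' <;> omega
  subst this
  rfl

lemma smallSyndrome_surjective : Function.Surjective smallSyndrome := by
  refine ((Fintype.bijective_iff_injective_and_card _).2 ⟨smallSyndrome_injective, ?_⟩).2
  rw [Fintype.card_prod, Fintype.card_coe, card_smallOddSets]
  simp [ZMod.card]

lemma exists_octad {S : Finset (Fin 24)} (hS : S.card = 5) : (octads S).Nonempty := by
  obtain ⟨⟨⟨U, hU⟩, b⟩, h⟩ := smallSyndrome_surjective (golayGen.mulVec (ind S))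
  have hmem := add_mem_G24_of_mulVec_eq h
  have hpar := dotProduct_eq_zero_of_mem_G24 hmem ind_univ_mem_G24
  simp only [add_dotProduct, smul_dotProduct, dotProduct_ind_univ,
    odd_card_of_mem_smallOddSets hU, hS] at hpar
  have hb : b = 0 := by
    simp only [Finset.card_singleton] at hpar
    clear hmem h
    revert b
    decide
  subst hb
  simp only [zero_smul, add_zero, ind_add_ind] at hmem
  have hc := card_symmDiff_add U S
  have hle := Finset.card_le_card (Finset.inter_subset_left (s₁ := U) (s₂ := S))
  have h8 := eight_le_card_of_ind_mem_G24 hmem fun h0 => by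
    have : U = S := symmDiff_eq_bot.1 h0
    rcases mem_smallOddSets.1 hU with h | h <;> rw [this] at h <;> omega
  have hcases := mem_smallOddSets.1 hU
  have hdisj : Disjoint U S := by
    rw [Finset.disjoint_iff_inter_eq_empty, ← Finset.card_eq_zero]
    omega
  refine ⟨symmDiff U S, mem_octads.2 ⟨hmem, by omega, ?_⟩⟩
  rw [hdisj.symmDiff_eq_sup]
  exact Finset.subset_union_right

lemma eq_of_five_le_card_inter {O O' : Finset (Fin 24)} (hO : ind O ∈ G24) (hO' : ind O' ∈ G24)
    (h8 : O.card = 8) (h8' : O'.card = 8) (h : 5 ≤ (O ∩ O').card) : O = O' := by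
  by_contra hne
  have h1 := eight_le_card_of_ind_mem_G24 (S := symmDiff O O')
    (by rw [← ind_add_ind]; exact add_mem_G24 hO hO') fun h => hne (symmDiff_eq_bot.1 h)
  have h2 := card_symmDiff_add O O'
  omega

lemma card_octads_five {S : Finset (Fin 24)} (hS : S.card = 5) : (octads S).card = 1 := by
  refine le_antisymm (Finset.card_le_one.2 fun O hO O' hO' => ?_)
    (Finset.card_pos.2 (exists_octad hS))
  rw [mem_octads] at hO hO'
  refine eq_of_five_le_card_inter hO.1 hO'.1 hO.2.1 hO'.2.1 ?_
  rw [← hS]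
  exact Finset.card_le_card (Finset.subset_inter hO.2.2 hO'.2.2)

lemma octads_insert (S : Finset (Fin 24)) (x : Fin 24) :
    octads (insert x S) = (octads S).filter fun O => x ∈ O := by
  ext O
  simp only [mem_octads, Finset.mem_filter, Finset.insert_subset_iff]
  tauto

lemma sum_card_octads_insert (S : Finset (Fin 24)) :
    ∑ x ∈ Sᶜ, (octads (insert x S)).card = (octads S).card * (8 - S.card) := by
  simp only [octads_insert, Finset.card_filter]
  rw [Finset.sum_comm, ← smul_eq_mul, ← Finset.sum_const]
  refine Finset.sum_congr rfl fun O hO => ?_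
  rw [mem_octads] at hO
  rw [← Finset.card_filter, ← hO.2.1, ← Finset.card_sdiff_of_subset hO.2.2]
  congr 1
  ext x
  simp [and_comm]

lemma card_octads_of_insert {S : Finset (Fin 24)} {m : ℕ}
    (h : ∀ x ∉ S, (octads (insert x S)).card = m) :
    (octads S).card * (8 - S.card) = (24 - S.card) * m := by
  rw [← sum_card_octads_insert, Finset.sum_congr rfl fun x hx => h x (Finset.mem_compl.1 hx),
    Finset.sum_const, Finset.card_compl, smul_eq_mul, Fintype.card_fin]

lemma card_octads_four {S : Finset (Fin 24)} (hS : S.card = 4) : (octads S).card = 5 := by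
  have := card_octads_of_insert (S := S) (m := 1) fun x hx =>
    card_octads_five (by rw [Finset.card_insert_of_notMem hx, hS])
  rw [hS] at this
  omega

lemma card_octads_three {S : Finset (Fin 24)} (hS : S.card = 3) : (octads S).card = 21 := by
  have := card_octads_of_insert (S := S) (m := 5) fun x hx =>
    card_octads_four (by rw [Finset.card_insert_of_notMem hx, hS])
  rw [hS] at this
  omega

/-! ### Linear systems attached to the octads -/

lemma sum_octads_sum (S : Finset (Fin 24)) (a : Fin 24 → ℂ) :
    ∑ O ∈ octads S, ∑ l ∈ O, a l = ∑ l, a l * (octads (insert l S)).card := by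
  have h : ∀ O ∈ octads S, ∑ l ∈ O, a l = ∑ l, if l ∈ O then a l else 0 := fun O _ => by
    rw [← Finset.sum_filter, Finset.filter_mem_eq_inter, Finset.univ_inter]
  rw [Finset.sum_congr rfl h, Finset.sum_comm]
  refine Finset.sum_congr rfl fun l _ => ?_
  rw [octads_insert, ← Finset.sum_filter, Finset.sum_const, nsmul_eq_mul, mul_comm]

lemma sum_mul_ite_mem (a : Fin 24 → ℂ) (S : Finset (Fin 24)) (p q : ℂ) :
    ∑ l, a l * (if l ∈ S then p + q else q) = q * ∑ l, a l + p * ∑ l ∈ S, a l := by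
  have h : ∀ l, a l * (if l ∈ S then p + q else q) = q * a l + if l ∈ S then p * a l else 0 := by
    intro l; split_ifs <;> ring
  simp only [h, Finset.sum_add_distrib, Finset.mul_sum]
  simp

lemma sum_octads_three_sum {T : Finset (Fin 24)} (hT : T.card = 3) (a : Fin 24 → ℂ) :
    ∑ O ∈ octads T, ∑ l ∈ O, a l = 5 * ∑ l, a l + 16 * ∑ l ∈ T, a l := by
  rw [sum_octads_sum, ← sum_mul_ite_mem]
  refine Finset.sum_congr rfl fun l _ => ?_
  congr 1
  split_ifs with h
  · rw [Finset.insert_eq_of_mem h, card_octads_three hT]; norm_num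
  · rw [card_octads_four (by rw [Finset.card_insert_of_notMem h, hT])]; norm_num

lemma sum_octads_four_sum {T : Finset (Fin 24)} (hT : T.card = 4) (a : Fin 24 → ℂ) :
    ∑ O ∈ octads T, ∑ l ∈ O, a l = ∑ l, a l + 4 * ∑ l ∈ T, a l := by
  rw [sum_octads_sum, ← one_mul (∑ l, a l), ← sum_mul_ite_mem]
  refine Finset.sum_congr rfl fun l _ => ?_
  congr 1
  split_ifs with h
  · rw [Finset.insert_eq_of_mem h, card_octads_four hT]; norm_num
  · rw [card_octads_five (by rw [Finset.card_insert_of_notMem h, hT])]; norm_num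

lemma octad_system_eq_zero {T : Finset (Fin 24)} (hT : T.card = 3) {a : Fin 24 → ℂ}
    {b : Finset (Fin 24) → ℂ} (h1 : ∀ O ∈ octads T, ∑ l ∈ O, a l + b O = 0)
    (h2 : ∀ m, (∑ l, a l + 8 * a m) * (if m ∈ T then -3 else 1) +
      ∑ O ∈ octads T, b O * (if m ∈ O \ T then -3 else 1) = 0) :
    (∀ l, a l = 0) ∧ ∀ O ∈ octads T, b O = 0 := by
  have hb : ∀ O ∈ octads T, b O = -∑ l ∈ O, a l := fun O hO => eq_neg_of_add_eq_zero_right (h1 O hO)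
  have hB : ∑ O ∈ octads T, b O = -(5 * ∑ l, a l + 16 * ∑ l ∈ T, a l) := by
    rw [← sum_octads_three_sum hT, ← Finset.sum_neg_distrib]
    exact Finset.sum_congr rfl hb
  have hout : ∀ m, m ∉ T → a m = 0 := by
    intro m hm
    have hC : ∑ O ∈ octads T, b O * (if m ∈ O \ T then -3 else 1) =
        ∑ O ∈ octads T, b O - 4 * ∑ O ∈ octads (insert m T), b O := by
      rw [octads_insert, Finset.sum_filter, Finset.mul_sum, ← Finset.sum_sub_distrib]
      refine Finset.sum_congr rfl fun O _ => ?_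
      simp only [Finset.mem_sdiff, hm, not_false_eq_true, and_true]
      split_ifs <;> ring
    have hD : ∑ O ∈ octads (insert m T), b O = -(∑ l, a l + 4 * (a m + ∑ l ∈ T, a l)) := by
      rw [← Finset.sum_insert hm, ← sum_octads_four_sum
        (by rw [Finset.card_insert_of_notMem hm, hT]), ← Finset.sum_neg_distrib]
      refine Finset.sum_congr rfl fun O hO => hb O ?_
      rw [octads_insert] at hO
      exact Finset.mem_of_mem_filter _ hO
    have := h2 m
    rw [hC, hB, hD, if_neg hm] at this
    linear_combination this / 24
  have hA : ∑ l, a l = ∑ l ∈ T, a l :=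
    (Finset.sum_subset (Finset.subset_univ T) fun l _ hl => hout l hl).symm
  have hin : ∀ m ∈ T, a m = -∑ l ∈ T, a l := by
    intro m hm
    have := h2 m
    simp only [Finset.mem_sdiff, hm, not_true_eq_false, and_false, if_false, if_true, mul_one, hB,
      hA] at this
    linear_combination -this / 24
  have ht : ∑ l ∈ T, a l = 0 := by
    have := Finset.sum_congr rfl hin
    rw [Finset.sum_const, hT, nsmul_eq_mul] at this
    push_cast at this
    linear_combination this / 4
  have ha : ∀ l, a l = 0 := fun l => by
    by_cases hl : l ∈ T
    · rw [hin l hl, ht, neg_zero]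
    · exact hout l hl
  exact ⟨ha, fun O hO => by rw [hb O hO]; simp [ha]⟩

lemma card_octads_insert_insert {T : Finset (Fin 24)} (hT : T.card = 3) (j k : Fin 24) :
    ((octads (insert j (insert k T))).card : ℂ) =
      1 + 4 * (if j ∈ T then 1 else 0) + 4 * (if k ∈ T then 1 else 0) +
        12 * ((if j ∈ T then 1 else 0) * (if k ∈ T then 1 else 0)) +
        4 * ((if j = k then 1 else 0) * (1 - if j ∈ T then 1 else 0)) := by
  by_cases hk : k ∈ T
  · rw [Finset.insert_eq_of_mem hk]
    by_cases hj : j ∈ T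
    · rw [Finset.insert_eq_of_mem hj, card_octads_three hT]
      simp [hj, hk]; norm_num
    · rw [card_octads_four (by rw [Finset.card_insert_of_notMem hj, hT])]
      have : j ≠ k := fun h => hj (h ▸ hk)
      simp [hj, hk, this]; norm_num
  · have h4 : (insert k T).card = 4 := by rw [Finset.card_insert_of_notMem hk, hT]
    by_cases hj : j ∈ insert k T
    · rw [Finset.insert_eq_of_mem hj, card_octads_four h4]
      rcases Finset.mem_insert.1 hj with rfl | hj
      · simp [hk]; norm_num
      · have : j ≠ k := fun h => hk (h ▸ hj)
        simp [hj, hk, this]; norm_num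
    · rw [card_octads_five (by rw [Finset.card_insert_of_notMem hj, h4])]
      rw [Finset.mem_insert, not_or] at hj
      simp [hj, hk]

lemma sum_octads_sum_sum {T : Finset (Fin 24)} (hT : T.card = 3) {s : Fin 24 → Fin 24 → ℂ}
    (hs : ∀ j k, s j k = s k j) :
    ∑ O ∈ octads T, ∑ j ∈ O, ∑ k ∈ O, s j k =
      ∑ j, ∑ k, s j k + 8 * ∑ j ∈ T, ∑ k, s j k + 12 * ∑ j ∈ T, ∑ k ∈ T, s j k +
        4 * (∑ j, s j j - ∑ j ∈ T, s j j) := by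
  have e1 : ∀ O ∈ octads T, ∑ j ∈ O, ∑ k ∈ O, s j k =
      ∑ j, ∑ k, if j ∈ O ∧ k ∈ O then s j k else 0 := by
    intro O _
    simp only [ite_and]
    simp [Finset.sum_ite_mem]
  have e2 : ∑ O ∈ octads T, ∑ j ∈ O, ∑ k ∈ O, s j k =
      ∑ j, ∑ k, s j k * (octads (insert j (insert k T))).card := by
    rw [Finset.sum_congr rfl e1, Finset.sum_comm]
    refine Finset.sum_congr rfl fun j _ => ?_
    rw [Finset.sum_comm]
    refine Finset.sum_congr rfl fun k _ => ?_
    rw [octads_insert, octads_insert, Finset.filter_filter, ← Finset.sum_filter, Finset.sum_const,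
      nsmul_eq_mul, mul_comm]
    simp only [and_comm]
  have e3 : ∑ j, ∑ k ∈ T, s j k = ∑ j ∈ T, ∑ k, s j k := by
    rw [Finset.sum_comm]
    simp only [hs]
  rw [e2]
  simp only [card_octads_insert_insert hT, mul_add, Finset.sum_add_distrib, mul_one,
    mul_left_comm _ (4 : ℂ),
    mul_left_comm _ (12 : ℂ), ← Finset.mul_sum, mul_sub, Finset.sum_sub_distrib]
  simp only [mul_ite, mul_one, mul_zero, Finset.sum_ite_irrel, Finset.sum_const_zero,
    Finset.sum_ite_mem, Finset.univ_inter, Finset.sum_ite_eq, Finset.mem_univ, if_true, e3]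
  simp
  ring

/-- A quadratic form in the squares of the coordinates, with symmetric matrix `s`, is zero if it
vanishes at all points of `L24` with a nonzero coordinate at `i`. -/
lemma quadric_system_eq_zero {i : Fin 24} {s : Fin 24 → Fin 24 → ℂ} (hs : ∀ j k, s j k = s k j)
    (h1 : ∀ j, j ≠ i → s i i + 2 * s i j + s j j = 0)
    (h2 : ∀ O ∈ octads {i}, ∑ j ∈ O, ∑ k ∈ O, s j k = 0)
    (h3 : ∀ m, ∑ j, ∑ k, s j k + 16 * ∑ k, s m k + 64 * s m m = 0) (j k : Fin 24) :
    s j k = 0 := by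
  set A := ∑ j, ∑ k, s j k with hA
  set D := ∑ j, s j j with hD
  have hR : ∀ m, ∑ k, s m k = -A / 16 - 4 * s m m := fun m => by
    linear_combination (h3 m) / 16
  have hI : ∀ j, j ≠ i → s i j = -(s i i + s j j) / 2 := fun j hj => by
    linear_combination (h1 j hj) / 2
  have hoff : ∀ a b, a ≠ i → b ≠ i → a ≠ b →
      24 * s a b = A / 2 - 4 * D + 48 * s i i + 36 * (s a a + s b b) := by
    intro a b ha hb hab
    have hT : ({i, a, b} : Finset (Fin 24)).card = 3 := by
      rw [Finset.card_eq_three]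
      exact ⟨i, a, b, ha.symm, hb.symm, hab, rfl⟩
    have key := sum_octads_sum_sum hT hs
    rw [Finset.sum_eq_zero fun O hO => h2 O ?_, ← hA, ← hD] at key
    · have hi : i ∉ ({a, b} : Finset (Fin 24)) := by simp [ha.symm, hb.symm]
      have ha' : a ∉ ({b} : Finset (Fin 24)) := by simpa using hab
      simp only [Finset.sum_insert hi, Finset.sum_insert ha', Finset.sum_singleton, hR,
        hs a i, hs b i, hs b a, hI a ha, hI b hb] at key
      linear_combination -key
    · rw [mem_octads] at hO ⊢
      exact ⟨hO.1, hO.2.1, (Finset.singleton_subset_iff.2 (by simp)).trans hO.2.2⟩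
  have hsum : ∀ a, a ≠ i → ∀ f : Fin 24 → ℂ,
      ∑ b, f b = f i + (f a + ∑ b ∈ (Finset.univ.erase i).erase a, f b) := by
    intro a ha f
    rw [Finset.add_sum_erase _ _ (by simp [ha]), Finset.add_sum_erase _ _ (Finset.mem_univ i)]
  have hdiag : ∀ a, a ≠ i → -864 * s a a = 25 / 2 * A - 52 * D + 1008 * s i i := by
    intro a ha
    have e1 := hsum a ha (s a)
    have e2 := hsum a ha fun b => s b b
    have e3 : ∑ b ∈ (Finset.univ.erase i).erase a, 24 * s a b =
        ∑ b ∈ (Finset.univ.erase i).erase a,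
          (A / 2 - 4 * D + 48 * s i i + 36 * (s a a + s b b)) := by
      refine Finset.sum_congr rfl fun b hb => ?_
      simp only [Finset.mem_erase, Finset.mem_univ, and_true] at hb
      exact hoff a b ha hb.2 hb.1.symm
    rw [← Finset.mul_sum, Finset.sum_add_distrib, Finset.sum_const, ← Finset.mul_sum,
      Finset.sum_add_distrib, Finset.sum_const, Finset.card_erase_of_mem (by simp [ha]),
      Finset.card_erase_of_mem (Finset.mem_univ i), Finset.card_univ, Fintype.card_fin,
      nsmul_eq_mul, nsmul_eq_mul] at e3
    push_cast at e3
    rw [hR, hs a i, hI a ha] at e1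
    rw [← hD] at e2
    linear_combination e3 + 24 * e1 - 36 * e2
  set p := s i i with hp
  obtain ⟨q, hq⟩ : ∃ q, q = -(25 / 2 * A - 52 * D + 1008 * p) / 864 := ⟨_, rfl⟩
  have hdq : ∀ a, a ≠ i → s a a = q := fun a ha => by
    rw [hq]; linear_combination -(hdiag a ha) / 864
  have hconst : ∀ f : Fin 24 → ℂ, ∀ c, (∀ a, a ≠ i → f a = c) → ∑ a, f a = f i + 23 * c := by
    intro f c hf
    rw [← Finset.add_sum_erase _ _ (Finset.mem_univ i),
      Finset.sum_congr rfl fun a ha => hf a (Finset.ne_of_mem_erase ha), Finset.sum_const,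
      Finset.card_erase_of_mem (Finset.mem_univ i), Finset.card_univ, Fintype.card_fin,
      nsmul_eq_mul]
    norm_num
  have eD : D = p + 23 * q := hconst _ q hdq
  have eR : -A / 16 - 4 * p = p + 23 * (-(p + q) / 2) := by
    rw [← hR i]
    exact hconst _ _ fun a ha => by rw [hI a ha, hdq a ha]
  have eA : A = 24 * (-A / 16) - 4 * D := by
    conv_lhs => rw [hA]
    simp only [hR, Finset.sum_sub_distrib, ← Finset.mul_sum]
    simp [← hD]
  have hA' : A = 104 * p + 184 * q := by linear_combination -16 * eR
  have e1 : -1968 * q = 2256 * p := by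
    rw [eD, hA'] at hq
    linear_combination -864 * hq
  have e2 : 264 * p + 552 * q = 0 := by
    rw [eD, hA'] at eA
    linear_combination eA
  have hp0 : p = 0 := by linear_combination (1968 * e2 + 552 * e1) / (1968 * 264 - 552 * 2256)
  have hq0 : q = 0 := by linear_combination (e2 - 264 * hp0) / 552
  have hd : ∀ a, s a a = 0 := fun a => by
    by_cases ha : a = i
    · rw [ha]; exact hp0
    · rw [hdq a ha, hq0]
  have hA0 : A = 0 := by rw [hA', hp0, hq0]; ring
  have hD0 : D = 0 := by rw [eD, hp0, hq0]; ring
  have hi : ∀ k, s i k = 0 := fun k => by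
    by_cases hk : k = i
    · rw [hk]; exact hd i
    · rw [hI k hk, hp0, hd k]; ring
  by_cases hj : j = i
  · rw [hj, hi]
  by_cases hk : k = i
  · rw [hk, hs, hi]
  by_cases hjk : j = k
  · rw [hjk, hd]
  have := hoff j k hj hk hjk
  rw [hA0, hD0, hp0, hd, hd] at this
  linear_combination this / 24

/-! ### Points of `L24` -/

/-- Change the signs of the coordinates in the support of a binary vector. -/
def signFlip (c : Fin 24 → ZMod 2) (v : Fin 24 → ℝ) : Fin 24 → ℝ :=
  fun i => if c i = 0 then v i else -v i

lemma signFlip_mem_L24 {c : Fin 24 → ZMod 2} (hc : c ∈ G24) {v : Fin 24 → ℝ} (hv : v ∈ L24) :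
    signFlip c v ∈ L24 := by
  rcases hv with ⟨d, hd, h8, h1, h2, h3⟩ | ⟨d, hd, i₀, h1, h2, h3⟩ | ⟨i, j, hij, hi, hj, h0⟩
  · refine Or.inl ⟨d, hd, h8, fun i hi => ?_, fun i hi => ?_, ?_⟩
    · unfold signFlip
      split_ifs
      · exact h1 i hi
      · rcases h1 i hi with h | h <;> simp [h]
    · simp [signFlip, h2 i hi]
    · set N := Finset.univ.filter fun i => v i = (-2 : ℝ)
      set D := Finset.univ.filter fun i => d i ≠ 0
      set C := Finset.univ.filter fun i => c i ≠ 0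
      have hN : (Finset.univ.filter fun i => signFlip c v i = (-2 : ℝ)) = symmDiff N (D ∩ C) := by
        ext i
        simp only [N, D, C, Finset.mem_symmDiff, Finset.mem_filter, Finset.mem_inter,
          Finset.mem_univ, true_and]
        simp only [signFlip]
        by_cases hdi : d i = 0
        · simp [hdi, h2 i hdi]
        · rcases h1 i hdi with h | h <;> by_cases hci : c i = 0 <;> simp [h, hci, hdi] <;> norm_num
      have he : Even (D ∩ C).card :=
        even_card_inter (by rwa [ind_support]) (by rwa [ind_support])
      have := card_symmDiff_add N (D ∩ C)
      rw [hN]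
      rw [Nat.even_iff] at *
      omega
  · refine Or.inr (Or.inl ⟨d + c, add_mem_G24 hd hc, i₀, ?_, fun i hi => ?_, fun i => ?_⟩)
    · unfold signFlip
      split_ifs
      · exact h1
      · rcases h1 with h | h <;> simp [h]
    · unfold signFlip
      split_ifs
      · exact h2 i hi
      · rcases h2 i hi with h | h <;> simp [h]
    · rcases zmod_two_cases (c i) with hci | hci
      · simp only [signFlip, hci, if_true, Pi.add_apply, add_zero, h3]
      · have hvi : v i = 3 ∨ v i = -3 ∨ v i = 1 ∨ v i = -1 := by
          by_cases hi : i = i₀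
          · rw [hi]; tauto
          · have := h2 i hi; tauto
        have h3i := h3 i
        rcases zmod_two_cases (d i) with hdi | hdi <;>
          rcases hvi with h | h | h | h <;>
          simp [signFlip, hci, hdi, h, CharTwo.add_self_eq_zero] at h3i ⊢ <;> norm_num at *
  · refine Or.inr (Or.inr ⟨i, j, hij, ?_, ?_, fun l hl hl' => ?_⟩)
    · unfold signFlip
      split_ifs
      · exact hi
      · rcases hi with h | h <;> simp [h]
    · unfold signFlip
      split_ifs
      · exact hj
      · rcases hj with h | h <;> simp [h]
    · simp [signFlip, h0 l hl hl']

lemma octad_mem_L24 {O : Finset (Fin 24)} (hO : ind O ∈ G24) (h8 : O.card = 8) :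
    (fun l => if l ∈ O then (2 : ℝ) else 0) ∈ L24 := by
  refine Or.inl ⟨ind O, hO, by rw [support_ind, h8], fun i hi => ?_, fun i hi => ?_, ?_⟩
  · left; simpa [ind] using hi
  · simpa [ind] using hi
  · rw [Finset.filter_eq_empty_iff.2 fun i _ => ?_]
    · exact Even.zero
    · dsimp only
      split_ifs <;> norm_num

lemma pair_mem_L24 {i j : Fin 24} (h : i ≠ j) :
    (fun l => if l ∈ ({i, j} : Finset (Fin 24)) then (4 : ℝ) else 0) ∈ L24 := by
  refine Or.inr (Or.inr ⟨i, j, h, by simp, by simp, fun l hi hj => by simp [hi, hj]⟩)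

lemma neg_three_mem_L24 (m : Fin 24) : (fun l => if l = m then (-3 : ℝ) else 1) ∈ L24 := by
  refine Or.inr (Or.inl ⟨ind Finset.univ, ind_univ_mem_G24, m, by simp, fun i hi => by simp [hi],
    fun i => ?_⟩)
  by_cases h : i = m <;> simp [ind, h]

/-! ### Splitting a polynomial along the cosets of the Golay code -/

/-- The exponents of a monomial modulo two. -/
def parityVec (α : Fin 24 →₀ ℕ) : Fin 24 → ZMod 2 := fun i => (α i : ZMod 2)

lemma prod_signFlip (c : Fin 24 → ZMod 2) (v : Fin 24 → ℝ) (α : Fin 24 →₀ ℕ) :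
    ∏ i, cx24 (signFlip c v) i ^ α i =
      (if c ⬝ᵥ parityVec α = 0 then 1 else -1) * ∏ i, cx24 v i ^ α i := by
  have h : ∀ i, cx24 (signFlip c v) i ^ α i = (-1) ^ ((c i).val * α i) * cx24 v i ^ α i := by
    intro i
    rcases zmod_two_cases (c i) with hc | hc
    · rw [cx24, cx24, signFlip, hc, if_pos rfl, ZMod.val_zero, zero_mul, pow_zero, one_mul]
    · rw [cx24, cx24, signFlip, hc, if_neg one_ne_zero, show (1 : ZMod 2).val = 1 from rfl,
        one_mul, Complex.ofReal_neg, neg_pow]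
  have hn : c ⬝ᵥ parityVec α = ((∑ i, (c i).val * α i : ℕ) : ZMod 2) := by
    rw [Nat.cast_sum]
    refine Finset.sum_congr rfl fun i _ => ?_
    rw [Nat.cast_mul, ZMod.natCast_zmod_val, parityVec]
  simp only [h, Finset.prod_mul_distrib, Finset.prod_pow_eq_pow_sum, hn,
    ZMod.natCast_eq_zero_iff_even]
  split_ifs with he
  · rw [he.neg_one_pow]
  · rw [(Nat.not_even_iff_odd.1 he).neg_one_pow]

lemma sum_filter_dotProduct_eq_zero {S : Finset (Fin 24 →₀ ℕ)} {k : (Fin 24 →₀ ℕ) → ℂ}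
    (h : ∀ v ∈ L24, ∑ α ∈ S, k α * ∏ i, cx24 v i ^ α i = 0) {c : Fin 24 → ZMod 2} (hc : c ∈ G24)
    (t : ZMod 2) :
    ∀ v ∈ L24, ∑ α ∈ S.filter (fun α => c ⬝ᵥ parityVec α = t), k α * ∏ i, cx24 v i ^ α i = 0 := by
  intro v hv
  have h2 := h _ (signFlip_mem_L24 hc hv)
  have key : ∀ α, (if c ⬝ᵥ parityVec α = t then k α * ∏ i, cx24 v i ^ α i else 0) =
      (1 / 2) * (k α * ∏ i, cx24 v i ^ α i) + (if t = 0 then 1 / 2 else -(1 / 2)) *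
        (k α * ∏ i, cx24 (signFlip c v) i ^ α i) := by
    intro α
    rw [prod_signFlip]
    rcases zmod_two_cases t with rfl | rfl <;>
      rcases zmod_two_cases (c ⬝ᵥ parityVec α) with h | h <;> simp [h] <;> ring
  rw [Finset.sum_filter]
  simp only [key, Finset.sum_add_distrib, ← Finset.mul_sum, h v hv, h2, mul_zero, add_zero]

lemma sum_filter_rows_eq_zero {S : Finset (Fin 24 →₀ ℕ)} {k : (Fin 24 →₀ ℕ) → ℂ}
    (h : ∀ v ∈ L24, ∑ α ∈ S, k α * ∏ i, cx24 v i ^ α i = 0) (t : Fin 12 → ZMod 2)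
    (I : Finset (Fin 12)) :
    ∀ v ∈ L24, ∑ α ∈ S.filter (fun α => ∀ r ∈ I, golayGen r ⬝ᵥ parityVec α = t r),
      k α * ∏ i, cx24 v i ^ α i = 0 := by
  induction I using Finset.induction_on with
  | empty => simpa using h
  | insert r I _ ih =>
    intro v hv
    have := sum_filter_dotProduct_eq_zero ih (golayGen_row_mem_G24 r) (t r) v hv
    rw [Finset.filter_filter] at this
    simpa only [Finset.forall_mem_insert, and_comm] using this

/-- The part of a polynomial formed by the monomials whose exponents are congruent modulo two to
a given vector modulo the Golay code. -/
noncomputable def cosetPart (P : MvPolynomial (Fin 24) ℂ) (T : Fin 24 → ZMod 2) :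
    MvPolynomial (Fin 24) ℂ :=
  open Classical in
  ∑ α ∈ P.support.filter (fun α => parityVec α + T ∈ G24), monomial α (coeff α P)

lemma parityVec_add_mem_G24_iff (α : Fin 24 →₀ ℕ) (T : Fin 24 → ZMod 2) :
    parityVec α + T ∈ G24 ↔
      ∀ r ∈ Finset.univ, golayGen r ⬝ᵥ parityVec α = golayGen.mulVec T r := by
  rw [mem_G24_iff, Matrix.mulVec_add, funext_iff]
  simp only [Finset.mem_univ, forall_const]
  refine forall_congr' fun r => ?_
  rw [Pi.add_apply, Pi.zero_apply, CharTwo.add_eq_zero]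
  rfl

lemma eval_cosetPart {P : MvPolynomial (Fin 24) ℂ} (h : ∀ v ∈ L24, eval (cx24 v) P = 0)
    (T : Fin 24 → ZMod 2) : ∀ v ∈ L24, eval (cx24 v) (cosetPart P T) = 0 := by
  intro v hv
  simp only [eval_eq'] at h
  have := sum_filter_rows_eq_zero h (golayGen.mulVec T) Finset.univ v hv
  classical
  rw [cosetPart, map_sum, ← this]
  refine Finset.sum_congr
    (Finset.filter_congr fun α _ => parityVec_add_mem_G24_iff α T) fun α _ => ?_
  rw [eval_monomial, Finsupp.prod_fintype _ _ (by simp)]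

lemma coeff_cosetPart (P : MvPolynomial (Fin 24) ℂ) {T : Fin 24 → ZMod 2} {α : Fin 24 →₀ ℕ}
    (h : parityVec α + T ∈ G24) : coeff α (cosetPart P T) = coeff α P := by
  classical
  rw [cosetPart, coeff_sum]
  simp only [coeff_monomial]
  rw [Finset.sum_ite_eq']
  simp [h]
  tauto

lemma prod_pow_eq_one_of_sum_eq_zero {M : Type*} [CommMonoid M] (y : Fin 24 → M)
    {β : Fin 24 → ℕ} (h : ∑ i, β i = 0) : ∏ i, y i ^ β i = 1 :=
  Finset.prod_eq_one fun i hi => by rw [Finset.sum_eq_zero_iff.1 h i hi, pow_zero]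

lemma exists_prod_pow_eq_mul {M : Type*} [CommMonoid M] (y : Fin 24 → M) {β : Fin 24 → ℕ} {n : ℕ}
    (h : ∑ i, β i = n + 1) :
    ∃ (l : Fin 24) (β' : Fin 24 → ℕ), ∑ i, β' i = n ∧ ∏ i, y i ^ β i = y l * ∏ i, y i ^ β' i := by
  obtain ⟨l, -, hl⟩ := Finset.exists_ne_zero_of_sum_ne_zero (h.trans_ne n.succ_ne_zero)
  have hβ : ∀ i,
      β i = (β - Pi.single l 1 : Fin 24 → ℕ) i + (Pi.single l 1 : Fin 24 → ℕ) i := fun i => by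
    by_cases hi : i = l
    · subst hi; simp; omega
    · simp [hi]
  refine ⟨l, β - Pi.single l 1, ?_, ?_⟩
  · have := Finset.sum_congr rfl fun i (_ : i ∈ Finset.univ) => hβ i
    rw [h, Finset.sum_add_distrib, Finset.sum_pi_single'] at this
    simp only [Finset.mem_univ, if_true] at this
    omega
  · rw [Finset.prod_congr rfl fun i _ => congrArg (y i ^ ·) (hβ i)]
    simp only [pow_add, Finset.prod_mul_distrib]
    rw [mul_comm, Finset.prod_eq_single (f := fun i => y i ^ (Pi.single l 1 : Fin 24 → ℕ) i) l
      (fun i _ hi => by rw [Pi.single_eq_of_ne hi, pow_zero]) (by simp), Pi.single_eq_same,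
      pow_one]

lemma quintic_monomial_cases {α : Fin 24 →₀ ℕ} (hα : ∑ i, α i = 5) (c : ℂ) :
    ∃ S : Finset (Fin 24), parityVec α = ind S ∧
      ((S.card = 1 ∧ ∃ j k, monomial α c = C c * ((∏ i ∈ S, X i) * (X j ^ 2 * X k ^ 2))) ∨
        (S.card = 3 ∧ ∃ l, monomial α c = C c * ((∏ i ∈ S, X i) * X l ^ 2)) ∨
        (S.card = 5 ∧ monomial α c = C c * ∏ i ∈ S, X i)) := by
  set S : Finset (Fin 24) := Finset.univ.filter fun i => α i % 2 = 1 with hS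
  set β : Fin 24 → ℕ := fun i => α i / 2
  have hαβ : ∀ i, α i = (if i ∈ S then 1 else 0) + 2 * β i := fun i => by
    simp only [hS, Finset.mem_filter, Finset.mem_univ, true_and, β]
    split_ifs <;> omega
  have hcard : S.card + 2 * ∑ i, β i = 5 := by
    rw [← hα, Finset.sum_congr rfl fun i _ => hαβ i, Finset.sum_add_distrib, ← Finset.mul_sum]
    simp
  have hodd : ∏ i, (X i : MvPolynomial (Fin 24) ℂ) ^ (if i ∈ S then 1 else 0) =
      ∏ i ∈ S, X i := by
    simp only [pow_ite, pow_one, pow_zero, Finset.prod_ite_mem, Finset.univ_inter]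
  have hprod : monomial α c = C c * ((∏ i ∈ S, X i) * ∏ i, (X i ^ 2) ^ β i) := by
    rw [monomial_eq, Finsupp.prod_fintype _ _ (by simp),
      Finset.prod_congr rfl fun i _ => congrArg (X i ^ ·) (hαβ i)]
    simp only [pow_add, pow_mul, Finset.prod_mul_distrib]
    rw [hodd]
  refine ⟨S, ?_, ?_⟩
  · funext i
    rw [parityVec, ind, hαβ i]
    push_cast
    rw [CharTwo.two_eq_zero (R := ZMod 2), zero_mul, add_zero]
  · obtain h | h | h : (∑ i, β i = 0) ∨ (∑ i, β i = 0 + 1) ∨ (∑ i, β i = 0 + 1 + 1) := by omega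
    · refine Or.inr (Or.inr ⟨by omega, ?_⟩)
      rw [hprod, prod_pow_eq_one_of_sum_eq_zero _ h, mul_one]
    · obtain ⟨l, β', h', he⟩ := exists_prod_pow_eq_mul
        (fun i => (X i ^ 2 : MvPolynomial (Fin 24) ℂ)) h
      refine Or.inr (Or.inl ⟨by omega, l, ?_⟩)
      rw [hprod, he, prod_pow_eq_one_of_sum_eq_zero _ h', mul_one]
    · obtain ⟨j, β', h', he⟩ := exists_prod_pow_eq_mul
        (fun i => (X i ^ 2 : MvPolynomial (Fin 24) ℂ)) h
      obtain ⟨k, β'', h'', he'⟩ := exists_prod_pow_eq_mul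
        (fun i => (X i ^ 2 : MvPolynomial (Fin 24) ℂ)) h'
      refine Or.inl ⟨by omega, j, k, ?_⟩
      rw [hprod, he, he', prod_pow_eq_one_of_sum_eq_zero _ h'', mul_one]

/-- The variable `X i` times a quadratic form in the squares of the variables. -/
noncomputable def squareForm (i : Fin 24) (q : Fin 24 → Fin 24 → ℂ) : MvPolynomial (Fin 24) ℂ :=
  X i * ∑ j, ∑ k, C (q j k) * (X j ^ 2 * X k ^ 2)

lemma eval_squareForm (i : Fin 24) (q : Fin 24 → Fin 24 → ℂ) (x : Fin 24 → ℂ) :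
    eval x (squareForm i q) = x i * ∑ j, ∑ k, q j k * (x j ^ 2 * x k ^ 2) := by
  simp [squareForm]

lemma two_mul_sum_sum (q : Fin 24 → Fin 24 → ℂ) (z : Fin 24 → ℂ) :
    2 * ∑ j, ∑ k, q j k * (z j * z k) = ∑ j, ∑ k, (q j k + q k j) * (z j * z k) := by
  have h : ∑ j, ∑ k, q k j * (z j * z k) = ∑ j, ∑ k, q j k * (z j * z k) := by
    rw [Finset.sum_comm]
    simp only [mul_comm]
  simp only [add_mul, Finset.sum_add_distrib, h]
  ring

lemma sum_sum_mul_indicator (s : Fin 24 → Fin 24 → ℂ) (S : Finset (Fin 24)) (r : ℂ) :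
    ∑ j, ∑ k, s j k * ((if j ∈ S then r else 0) * (if k ∈ S then r else 0)) =
      r ^ 2 * ∑ j ∈ S, ∑ k ∈ S, s j k := by
  simp only [mul_ite, ite_mul, zero_mul, mul_zero, Finset.sum_ite_irrel, Finset.sum_const_zero,
    Finset.sum_ite_mem, Finset.univ_inter, ← Finset.sum_mul]
  ring

lemma sum_sum_mul_add_ite (s : Fin 24 → Fin 24 → ℂ) (hs : ∀ j k, s j k = s k j) (m : Fin 24)
    (r : ℂ) :
    ∑ j, ∑ k, s j k * ((1 + if j = m then r else 0) * (1 + if k = m then r else 0)) =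
      ∑ j, ∑ k, s j k + 2 * r * ∑ k, s m k + r ^ 2 * s m m := by
  have h : ∑ j, s j m = ∑ j, s m j := Finset.sum_congr rfl fun j _ => hs j m
  simp only [mul_add, add_mul, mul_one, one_mul, mul_ite, ite_mul, zero_mul, mul_zero,
    Finset.sum_add_distrib, Finset.sum_ite_irrel, Finset.sum_const_zero, Finset.sum_ite_eq',
    Finset.mem_univ, if_true, ← Finset.sum_mul, h]
  ring

lemma squareForm_eq_zero {i : Fin 24} {q : Fin 24 → Fin 24 → ℂ}
    (h : ∀ v ∈ L24, eval (cx24 v) (squareForm i q) = 0) : squareForm i q = 0 := by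
  set s : Fin 24 → Fin 24 → ℂ := fun j k => q j k + q k j with hsdef
  have hs : ∀ j k, s j k = s k j := fun j k => add_comm _ _
  have hz : ∀ v ∈ L24, v i ≠ 0 →
      ∑ j, ∑ k, s j k * ((v j : ℂ) ^ 2 * (v k : ℂ) ^ 2) = 0 := by
    intro v hv hvi
    have := h v hv
    rw [eval_squareForm, mul_eq_zero] at this
    rw [← two_mul_sum_sum q fun j => (v j : ℂ) ^ 2]
    rw [show ∑ j, ∑ k, q j k * ((v j : ℂ) ^ 2 * (v k : ℂ) ^ 2) = 0 from
      this.resolve_left (Complex.ofReal_ne_zero.2 hvi), mul_zero]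
  have hind : ∀ (S : Finset (Fin 24)) (r : ℝ), r ≠ 0 → i ∈ S →
      (fun l => if l ∈ S then r else 0) ∈ L24 → ∑ j ∈ S, ∑ k ∈ S, s j k = 0 := by
    intro S r hr hi hv
    have e := hz _ hv (by simpa [hi] using hr)
    have hsq : ∀ l, (((if l ∈ S then r else 0 : ℝ)) : ℂ) ^ 2 =
        if l ∈ S then (r : ℂ) ^ 2 else 0 := by
      intro l; split_ifs <;> simp
    simp only [hsq] at e
    rw [sum_sum_mul_indicator, mul_eq_zero] at e
    exact e.resolve_left (by simpa using hr)
  have hs0 : ∀ j k, s j k = 0 := by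
    refine quadric_system_eq_zero (i := i) hs (fun j hj => ?_) (fun O hO => ?_) fun m => ?_
    · have := hind {i, j} 4 (by norm_num) (by simp) (pair_mem_L24 hj.symm)
      rw [Finset.sum_pair hj.symm, Finset.sum_pair hj.symm, Finset.sum_pair hj.symm, hs j i] at this
      linear_combination this
    · rw [mem_octads, Finset.singleton_subset_iff] at hO
      exact hind O 2 (by norm_num) hO.2.2 (octad_mem_L24 hO.1 hO.2.1)
    · have e := hz _ (neg_three_mem_L24 m) (by split_ifs <;> norm_num)
      have hsq : ∀ l, (((if l = m then -3 else 1 : ℝ)) : ℂ) ^ 2 = 1 + if l = m then 8 else 0 := by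
        intro l; split_ifs <;> norm_num
      simp only [hsq] at e
      rw [sum_sum_mul_add_ite s hs] at e
      linear_combination e
  refine MvPolynomial.funext fun x => ?_
  have := two_mul_sum_sum q fun j => x j ^ 2
  simp only [show ∀ j k, q j k + q k j = 0 from hs0, zero_mul, Finset.sum_const_zero] at this
  rw [eval_squareForm, (mul_eq_zero.1 this).resolve_left two_ne_zero, mul_zero, map_zero]

/-- A quintic formed by the monomials `∏_{i ∈ T} X_i * X_l ^ 2` and the squarefree monomials
supported on the complements of `T` in the octads containing it. -/
noncomputable def octadForm (T : Finset (Fin 24)) (a : Fin 24 → ℂ) (b : Finset (Fin 24) → ℂ) :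
    MvPolynomial (Fin 24) ℂ :=
  (∏ i ∈ T, X i) * ∑ l, C (a l) * X l ^ 2 + ∑ O ∈ octads T, C (b O) * ∏ i ∈ O \ T, X i

lemma eval_octadForm (T : Finset (Fin 24)) (a : Fin 24 → ℂ) (b : Finset (Fin 24) → ℂ)
    (x : Fin 24 → ℂ) :
    eval x (octadForm T a b) =
      (∏ i ∈ T, x i) * ∑ l, a l * x l ^ 2 + ∑ O ∈ octads T, b O * ∏ i ∈ O \ T, x i := by
  simp [octadForm]

lemma octadForm_eq_zero {T : Finset (Fin 24)} (hT : T.card = 3) {a : Fin 24 → ℂ}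
    {b : Finset (Fin 24) → ℂ} (h : ∀ v ∈ L24, eval (cx24 v) (octadForm T a b) = 0) :
    octadForm T a b = 0 := by
  suffices h' : (∀ l, a l = 0) ∧ ∀ O ∈ octads T, b O = 0 by
    rw [octadForm, Finset.sum_eq_zero fun l _ => by rw [h'.1 l, C_0, zero_mul],
      Finset.sum_eq_zero fun O hO => by rw [h'.2 O hO, C_0, zero_mul], mul_zero, add_zero]
  refine octad_system_eq_zero hT (fun O hO => ?_) fun m => ?_
  · have hO' := mem_octads.1 hO
    have e := h _ (octad_mem_L24 hO'.1 hO'.2.1)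
    rw [eval_octadForm, Finset.sum_eq_single O] at e
    · have h1 : ∀ S : Finset (Fin 24), S ⊆ O →
          ∏ i ∈ S, cx24 (fun l => if l ∈ O then (2 : ℝ) else 0) i = 2 ^ S.card := by
        intro S hS
        refine Finset.prod_eq_pow_card fun i hi => ?_
        simp [cx24, hS hi]
      have h2 : ∑ l, a l * cx24 (fun l => if l ∈ O then (2 : ℝ) else 0) l ^ 2 =
          4 * ∑ l ∈ O, a l := by
        rw [Finset.mul_sum, ← Finset.univ_inter O, ← Finset.sum_ite_mem]
        refine Finset.sum_congr rfl fun l _ => ?_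
        by_cases hl : l ∈ O
        · simp [cx24, hl]; ring
        · simp [cx24, hl]
      rw [h1 T hO'.2.2, h1 _ Finset.sdiff_subset, h2, Finset.card_sdiff_of_subset hO'.2.2, hT,
        hO'.2.1] at e
      norm_num at e
      linear_combination e / 32
    · intro U hU hne
      have hU' := mem_octads.1 hU
      obtain ⟨i, hi, hi'⟩ := Finset.not_subset.1 fun hUO : U ⊆ O =>
        hne (Finset.eq_of_subset_of_card_le hUO (by rw [hO'.2.1, hU'.2.1]))
      rw [Finset.prod_eq_zero (i := i), mul_zero]
      · exact Finset.mem_sdiff.2 ⟨hi, fun hiT => hi' (hO'.2.2 hiT)⟩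
      · simp [cx24, hi']
    · exact fun hne => absurd hO hne
  · have e := h _ (neg_three_mem_L24 m)
    have h1 : ∀ S : Finset (Fin 24),
        ∏ i ∈ S, cx24 (fun l => if l = m then (-3 : ℝ) else 1) i = if m ∈ S then -3 else 1 := by
      intro S
      rw [← Finset.prod_ite_eq' S m fun _ => (-3 : ℂ)]
      refine Finset.prod_congr rfl fun i _ => ?_
      by_cases hi : i = m <;> simp [cx24, hi]
    have h2 : ∑ l, a l * cx24 (fun l => if l = m then (-3 : ℝ) else 1) l ^ 2 =
        ∑ l, a l + 8 * a m := by
      have : ∀ l, a l * cx24 (fun l => if l = m then (-3 : ℝ) else 1) l ^ 2 =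
          a l + if l = m then 8 * a l else 0 := by
        intro l
        by_cases hl : l = m
        · simp [cx24, hl]; ring
        · simp [cx24, hl]
      simp [this, Finset.sum_add_distrib]
    simp only [eval_octadForm, h1, h2] at e
    rw [mul_comm]
    exact e

lemma sum_eq_of_mem_support {P : MvPolynomial (Fin 24) ℂ} {n : ℕ} (hP : P.IsHomogeneous n)
    {α : Fin 24 →₀ ℕ} (hα : α ∈ P.support) : ∑ i, α i = n := by
  have := hP (mem_support_iff.1 hα)
  simpa [Finsupp.weight_apply, Finsupp.sum_fintype] using this

lemma cosetPart_singleton {P : MvPolynomial (Fin 24) ℂ} (hP : P.IsHomogeneous 5) (i : Fin 24) :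
    ∃ q, cosetPart P (ind {i}) = squareForm i q := by
  classical
  refine Finset.sum_induction _ (fun R => ∃ q, R = squareForm i q) ?_ ?_ ?_
  · rintro _ _ ⟨q, rfl⟩ ⟨q', rfl⟩
    refine ⟨q + q', ?_⟩
    simp only [squareForm, Pi.add_apply, C_add, add_mul, Finset.sum_add_distrib, mul_add]
  · exact ⟨0, by simp [squareForm]⟩
  · intro α hα
    rw [Finset.mem_filter] at hα
    obtain ⟨S, hS, hcases⟩ := quintic_monomial_cases (sum_eq_of_mem_support hP hα.1) (coeff α P)
    have hSi : S = {i} := by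
      refine eq_of_symmDiff_card_lt (by rw [← ind_add_ind, ← hS]; exact hα.2) ?_
      rw [Finset.card_singleton]
      rcases hcases with h | h | h <;> omega
    subst hSi
    obtain ⟨j, k, h⟩ : ∃ j k, monomial α (coeff α P) =
        C (coeff α P) * ((∏ i ∈ {i}, X i) * (X j ^ 2 * X k ^ 2)) := by
      rcases hcases with h | h | h
      · exact h.2
      · simp at h
      · simp at h
    refine ⟨fun j' k' => if j' = j then if k' = k then coeff α P else 0 else 0, ?_⟩
    rw [h, squareForm, Finset.sum_eq_single j, Finset.sum_eq_single k] <;> simp +contextual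
    ring

lemma cosetPart_triple {P : MvPolynomial (Fin 24) ℂ} (hP : P.IsHomogeneous 5)
    {T : Finset (Fin 24)} (hT : T.card = 3) : ∃ a b, cosetPart P (ind T) = octadForm T a b := by
  classical
  refine Finset.sum_induction _ (fun R => ∃ a b, R = octadForm T a b) ?_ ?_ ?_
  · rintro _ _ ⟨a, b, rfl⟩ ⟨a', b', rfl⟩
    refine ⟨a + a', b + b', ?_⟩
    simp only [octadForm, Pi.add_apply, C_add, add_mul, Finset.sum_add_distrib, mul_add]
    ring
  · exact ⟨0, 0, by simp [octadForm]⟩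
  · intro α hα
    rw [Finset.mem_filter] at hα
    obtain ⟨S, hS, hcases⟩ := quintic_monomial_cases (sum_eq_of_mem_support hP hα.1) (coeff α P)
    have hmem : ind (symmDiff S T) ∈ G24 := by rw [← ind_add_ind, ← hS]; exact hα.2
    by_cases hST : S = T
    · subst hST
      obtain ⟨l, h⟩ : ∃ l, monomial α (coeff α P) =
          C (coeff α P) * ((∏ i ∈ S, X i) * X l ^ 2) := by
        rcases hcases with h | h | h
        · omega
        · exact h.2
        · omega
      refine ⟨fun l' => if l' = l then coeff α P else 0, 0, ?_⟩
      rw [h, octadForm, Finset.sum_eq_single l] <;> simp +contextual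
      ring
    · have h8 := eight_le_card_of_ind_mem_G24 hmem fun h => hST (symmDiff_eq_bot.1 h)
      have hc := card_symmDiff_add S T
      have hS5 : S.card = 5 := by rcases hcases with h | h | h <;> omega
      have hdisj : Disjoint S T := by
        rw [Finset.disjoint_iff_inter_eq_empty, ← Finset.card_eq_zero]
        omega
      have h : monomial α (coeff α P) = C (coeff α P) * ∏ i ∈ S, X i := by
        rcases hcases with h | h | h
        · omega
        · omega
        · exact h.2
      have hO : S ∪ T ∈ octads T := by
        rw [mem_octads, ← Finset.sup_eq_union, ← hdisj.symmDiff_eq_sup]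
        refine ⟨hmem, by omega, ?_⟩
        rw [hdisj.symmDiff_eq_sup]
        exact Finset.subset_union_right
      refine ⟨0, fun O => if O = S ∪ T then coeff α P else 0, ?_⟩
      rw [h, octadForm, Finset.sum_eq_single (S ∪ T)]
      · simp [Finset.union_sdiff_cancel_right hdisj]
      · intro O _ hne
        simp [hne]
      · exact fun hne => absurd hO hne

lemma quintic_eq_zero {P : MvPolynomial (Fin 24) ℂ} (hP : P.IsHomogeneous 5)
    (h : ∀ v ∈ L24, eval (cx24 v) P = 0) : P = 0 := by
  have hone : ∀ i, cosetPart P (ind {i}) = 0 := fun i => by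
    obtain ⟨q, hq⟩ := cosetPart_singleton hP i
    have := eval_cosetPart h (ind {i})
    rw [hq] at this ⊢
    exact squareForm_eq_zero this
  have hthree : ∀ T : Finset (Fin 24), T.card = 3 → cosetPart P (ind T) = 0 := fun T hT => by
    obtain ⟨a, b, hab⟩ := cosetPart_triple hP hT
    have := eval_cosetPart h (ind T)
    rw [hab] at this ⊢
    exact octadForm_eq_zero hT this
  ext α
  rw [coeff_zero]
  by_contra hα
  have hself : ∀ S, ind S + ind S ∈ G24 := fun S => by
    rw [mem_G24_iff, CharTwo.add_self_eq_zero, Matrix.mulVec_zero]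
  obtain ⟨S, hS, hcases⟩ :=
    quintic_monomial_cases (sum_eq_of_mem_support hP (mem_support_iff.2 hα)) (coeff α P)
  obtain ⟨T, hT, hmem⟩ : ∃ T : Finset (Fin 24), cosetPart P (ind T) = 0 ∧ ind S + ind T ∈ G24 := by
    rcases hcases with ⟨h1, -⟩ | ⟨h3, -⟩ | ⟨h5, -⟩
    · obtain ⟨i, rfl⟩ := Finset.card_eq_one.1 h1
      exact ⟨{i}, hone i, hself _⟩
    · exact ⟨S, hthree S h3, hself _⟩
    · obtain ⟨O, hO⟩ := exists_octad h5
      rw [mem_octads] at hO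
      refine ⟨O \ S, hthree _ (by rw [Finset.card_sdiff_of_subset hO.2.2, h5, hO.2.1]), ?_⟩
      rw [ind_add_ind, Finset.disjoint_sdiff.symmDiff_eq_sup, Finset.sup_eq_union,
        Finset.union_sdiff_of_subset hO.2.2]
      exact hO.1
  rw [← hS] at hmem
  exact hα (by rw [← coeff_cosetPart P hmem, hT, coeff_zero])

/-! ### The vanishing ideal of `L24` in low degree -/

lemma quartic_eq_zero {P : MvPolynomial (Fin 24) ℂ} (hP : P.IsHomogeneous 4)
    (h : ∀ v ∈ L24, eval (cx24 v) P = 0) : P = 0 := by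
  have := quintic_eq_zero ((isHomogeneous_X ℂ (0 : Fin 24)).mul hP) fun v hv => by
    rw [map_mul, h v hv, mul_zero]
  exact (mul_eq_zero.1 this).resolve_left (X_ne_zero 0)

lemma neg_mem_L24 {v : Fin 24 → ℝ} (hv : v ∈ L24) : -v ∈ L24 := by
  convert signFlip_mem_L24 ind_univ_mem_G24 hv using 1
  funext i
  simp [signFlip, ind]

lemma eval_cx24_neg {P : MvPolynomial (Fin 24) ℂ} {n : ℕ} (hP : P.IsHomogeneous n)
    (v : Fin 24 → ℝ) : eval (cx24 (-v)) P = (-1) ^ n * eval (cx24 v) P := by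
  rw [eval_eq', eval_eq', Finset.mul_sum]
  refine Finset.sum_congr rfl fun α hα => ?_
  have h : ∀ i, cx24 (-v) i ^ α i = (-1) ^ α i * cx24 v i ^ α i := fun i => by
    rw [← mul_pow]
    simp [cx24]
  simp only [h]
  rw [Finset.prod_mul_distrib, Finset.prod_pow_eq_pow_sum, sum_eq_of_mem_support hP hα]
  ring

lemma sum_sq_of_mem_L24 {v : Fin 24 → ℝ} (hv : v ∈ L24) : ∑ i, v i ^ 2 = 32 := by
  rcases hv with ⟨c, -, h8, h1, h2, -⟩ | ⟨c, -, i₀, h1, h2, -⟩ | ⟨i, j, hij, hi, hj, h0⟩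
  · have h : ∀ i, v i ^ 2 = if c i ≠ 0 then 4 else 0 := fun i => by
      split_ifs with hc
      · rcases h1 i hc with h | h <;> rw [h] <;> norm_num
      · rw [h2 i (not_not.1 hc)]; norm_num
    simp only [h]
    rw [← Finset.sum_filter, Finset.sum_const, h8]
    norm_num
  · have h : ∀ i, v i ^ 2 = 1 + if i = i₀ then 8 else 0 := fun i => by
      split_ifs with hc
      · rw [hc]; rcases h1 with h | h <;> rw [h] <;> norm_num
      · rcases h2 i hc with h | h <;> rw [h] <;> norm_num
    simp only [h, Finset.sum_add_distrib]
    norm_num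
  · have h : ∀ l, v l ^ 2 = (if l = i then 16 else 0) + if l = j then 16 else 0 := fun l => by
      by_cases hl : l = i
      · subst hl; rw [if_pos rfl, if_neg hij]; rcases hi with h | h <;> rw [h] <;> norm_num
      · by_cases hl' : l = j
        · subst hl'; rw [if_neg hl, if_pos rfl]; rcases hj with h | h <;> rw [h] <;> norm_num
        · rw [h0 l hl hl', if_neg hl, if_neg hl']; norm_num
    simp only [h, Finset.sum_add_distrib]
    norm_num

lemma eval_Nm24 (x : Fin 24 → ℂ) : eval x Nm24 = ∑ i, x i ^ 2 - 32 := by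
  simp [Nm24]

lemma eval_Nm24_of_mem_L24 {v : Fin 24 → ℝ} (hv : v ∈ L24) : eval (cx24 v) Nm24 = 0 := by
  rw [eval_Nm24, sub_eq_zero]
  simp only [cx24]
  exact_mod_cast congrArg Complex.ofReal (sum_sq_of_mem_L24 hv)

lemma Nm24_dvd {F : MvPolynomial (Fin 24) ℂ} (hF : F.totalDegree ≤ 5)
    (h : ∀ v ∈ L24, eval (cx24 v) F = 0) : Nm24 ∣ F := by
  set N : MvPolynomial (Fin 24) ℂ := ∑ i, X i ^ 2 with hN
  have hN2 : N.IsHomogeneous 2 := IsHomogeneous.sum _ _ _ fun i _ => isHomogeneous_X_pow i 2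
  have hNm : Nm24 = N - C 32 := rfl
  have hH : ∀ n, (homogeneousComponent n F).IsHomogeneous n := fun n =>
    homogeneousComponent_isHomogeneous n F
  have hlift : ∀ P : MvPolynomial (Fin 24) ℂ, Nm24 ∣ P - C (1 / 32) * P * N := fun P => by
    refine ⟨-C (1 / 32) * P, ?_⟩
    have : (C (1 / 32) * C 32 : MvPolynomial (Fin 24) ℂ) = 1 := by
      rw [← C_mul]; norm_num
    rw [hNm]
    linear_combination (-P) * this
  obtain ⟨P4, P5, h4, h5, hdvd⟩ : ∃ P4 P5 : MvPolynomial (Fin 24) ℂ,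
      P4.IsHomogeneous 4 ∧ P5.IsHomogeneous 5 ∧ Nm24 ∣ F - (P4 + P5) := by
    have hmul : ∀ {n : ℕ} {P : MvPolynomial (Fin 24) ℂ}, P.IsHomogeneous n →
        (C (1 / 32) * P * N).IsHomogeneous (n + 2) := fun hP =>
      (hP.C_mul _).mul hN2
    set H := fun n => homogeneousComponent n F with hHdef
    refine ⟨C (1 / 32) * (C (1 / 32) * H 0 * N + H 2) * N + H 4,
      C (1 / 32) * (C (1 / 32) * H 1 * N + H 3) * N + H 5,
      (hmul ((hmul (hH 0)).add (hH 2))).add (hH 4),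
      (hmul ((hmul (hH 1)).add (hH 3))).add (hH 5), ?_⟩
    have hsum : F = H 0 + H 1 + H 2 + H 3 + H 4 + H 5 := by
      conv_lhs => rw [← sum_homogeneousComponent F]
      rw [Finset.sum_subset (Finset.range_subset_range.2 (Nat.succ_le_succ hF)) fun n _ hn =>
        homogeneousComponent_eq_zero n F (by simpa using hn)]
      simp only [Finset.sum_range_succ, Finset.sum_range_zero, zero_add, hHdef]
    convert dvd_add (dvd_add (hlift (H 0)) (hlift (C (1 / 32) * H 0 * N + H 2)))
      (dvd_add (hlift (H 1)) (hlift (C (1 / 32) * H 1 * N + H 3))) using 1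
    rw [hsum]
    ring
  have hvan : ∀ v ∈ L24, eval (cx24 v) P4 + eval (cx24 v) P5 = 0 := fun v hv => by
    obtain ⟨Q, hQ⟩ := hdvd
    have := congrArg (eval (cx24 v)) hQ
    rw [map_sub, map_add, map_mul, eval_Nm24_of_mem_L24 hv, h v hv] at this
    linear_combination -this
  have hneg : ∀ v ∈ L24, eval (cx24 v) P4 - eval (cx24 v) P5 = 0 := fun v hv => by
    have := hvan _ (neg_mem_L24 hv)
    rw [eval_cx24_neg h4, eval_cx24_neg h5] at this
    linear_combination this
  have e4 := quartic_eq_zero h4 fun v hv => by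
    linear_combination (hvan v hv + hneg v hv) / 2
  have e5 := quintic_eq_zero h5 fun v hv => by
    linear_combination (hvan v hv - hneg v hv) / 2
  rwa [e4, e5, add_zero, sub_zero] at hdvd

/-- A sextic form vanishing on `L24`. -/
noncomputable def sexticForm : MvPolynomial (Fin 24) ℂ :=
  X 0 * X 1 * (X 0 ^ 2 - X 1 ^ 2) * (X 2 ^ 2 - X 3 ^ 2)

lemma eval_sexticForm (x : Fin 24 → ℂ) :
    eval x sexticForm = x 0 * x 1 * (x 0 ^ 2 - x 1 ^ 2) * (x 2 ^ 2 - x 3 ^ 2) := by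
  simp [sexticForm]

lemma eval_sexticForm_eq_zero {v : Fin 24 → ℝ} (hv : v ∈ L24) :
    eval (cx24 v) sexticForm = 0 := by
  suffices h : v 0 * v 1 * (v 0 ^ 2 - v 1 ^ 2) * (v 2 ^ 2 - v 3 ^ 2) = 0 by
    rw [eval_sexticForm]
    simp only [cx24]
    exact_mod_cast congrArg Complex.ofReal h
  rcases hv with ⟨c, -, -, h1, h2, -⟩ | ⟨c, -, i₀, -, h2, -⟩ | ⟨i, j, hij, hi, hj, h0⟩
  · have h : ∀ i, v i = 0 ∨ v i ^ 2 = 4 := fun i => by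
      by_cases hc : c i = 0
      · exact Or.inl (h2 i hc)
      · rcases h1 i hc with h | h <;> right <;> rw [h] <;> norm_num
    rcases h 0 with h0 | h0
    · simp [h0]
    · rcases h 1 with h1 | h1
      · simp [h1]
      · simp [h0, h1]
  · have h : ∀ i, i ≠ i₀ → v i ^ 2 = 1 := fun i hi => by
      rcases h2 i hi with h | h <;> rw [h] <;> norm_num
    by_cases h01 : i₀ = 0 ∨ i₀ = 1
    · rw [h 2 (by rintro rfl; revert h01; decide), h 3 (by rintro rfl; revert h01; decide)]
      ring
    · rw [not_or] at h01
      rw [h 0 (Ne.symm h01.1), h 1 (Ne.symm h01.2)]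
      ring
  · have h : ∀ l, v l = 0 ∨ (l = i ∨ l = j) ∧ v l ^ 2 = 16 := fun l => by
      by_cases hl : l = i
      · subst hl; right; refine ⟨Or.inl rfl, ?_⟩; rcases hi with h | h <;> rw [h] <;> norm_num
      · by_cases hl' : l = j
        · subst hl'; right; refine ⟨Or.inr rfl, ?_⟩; rcases hj with h | h <;> rw [h] <;> norm_num
        · exact Or.inl (h0 l hl hl')
    rcases h 0 with h0 | h0
    · simp [h0]
    · rcases h 1 with h1 | h1
      · simp [h1]
      · simp [h0.2, h1.2]

/-- A point of the complex sphere `Nm = 0` where the sextic form does not vanish. -/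
def spherePoint : Fin 24 → ℂ := fun i => if i = 1 then 2 else if i = 4 then 5 else
  if i = 0 ∨ i = 2 ∨ i = 5 then 1 else 0

lemma eval_spherePoint_Nm24 : eval spherePoint Nm24 = 0 := by
  rw [eval_Nm24]
  simp [spherePoint, Fin.sum_univ_succ]
  norm_num

lemma eval_spherePoint_sexticForm : eval spherePoint sexticForm ≠ 0 := by
  rw [eval_sexticForm]
  norm_num [spherePoint, Fin.ext_iff]

lemma totalDegree_sexticForm : sexticForm.totalDegree = 6 := by
  refine IsHomogeneous.totalDegree ?_ fun h => eval_spherePoint_sexticForm (by rw [h, map_zero])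
  exact (((isHomogeneous_X ℂ 0).mul (isHomogeneous_X ℂ 1)).mul
    ((isHomogeneous_X_pow 0 2).sub (isHomogeneous_X_pow 1 2))).mul
    ((isHomogeneous_X_pow 2 2).sub (isHomogeneous_X_pow 3 2))

lemma not_Nm24_dvd_sexticForm : ¬ Nm24 ∣ sexticForm := by
  rintro ⟨Q, hQ⟩
  apply eval_spherePoint_sexticForm
  rw [hQ, map_mul, eval_spherePoint_Nm24, zero_mul]

/-- Every `F ∈ ℂ[Y₁,…,Y₂₄]` of total degree at most `5` vanishing on
`L24` is divisible by `Nm`, and some polynomial of total degree `6` vanishing on `L24` is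
not divisible by `Nm`. -/
theorem statement17 :
    (∀ F : MvPolynomial (Fin 24) ℂ, F.totalDegree ≤ 5 →
      (∀ a ∈ L24, MvPolynomial.eval (cx24 a) F = 0) → Nm24 ∣ F) ∧
    ∃ F : MvPolynomial (Fin 24) ℂ, F.totalDegree = 6 ∧
      (∀ a ∈ L24, MvPolynomial.eval (cx24 a) F = 0) ∧ ¬ Nm24 ∣ F :=
  ⟨fun _ => Nm24_dvd, sexticForm, totalDegree_sexticForm, fun _ => eval_sexticForm_eq_zero,
    not_Nm24_dvd_sexticForm⟩
end

section
/- Let m ≥ 2 and let X be a finite subset of the unit sphere of ℝ^m that spans ℝ^m, with inner product set { a·b : a, b ∈ X } of size d + 1. Then there exists a polynomial F vanishing at every point of X with total degree at most d + 1 that is not divisible by Nm = Y_1² + ⋯ + Y_m² − 1; if moreover X is antipodal (X = −X), there exists such an F of total degree at most d. In addition, if X is not contained in any affine hyperplane of ℝ^m, then no nonzero polynomial of total degree at most 1 vanishes on X, so every nonzero polynomial vanishing on X and not divisible by Nm has degree at least 2. (Thus 2 ≤ γ_1(X) ≤ d + 1, and γ_1(X) ≤ d when X is antipodal.) -/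
open MvPolynomial

/-- The linear form `Y ↦ a · Y`, as a polynomial. -/
noncomputable def linearForm {m : ℕ} (a : Fin m → ℝ) : MvPolynomial (Fin m) ℝ :=
  ∑ i, C (a i) * X i

lemma eval_linearForm {m : ℕ} (a y : Fin m → ℝ) : eval y (linearForm a) = a ⬝ᵥ y := by
  simp [linearForm, dotProduct]

lemma totalDegree_linearForm_le {m : ℕ} (a : Fin m → ℝ) : (linearForm a).totalDegree ≤ 1 := by
  refine totalDegree_finsetSum_le fun i _ => ?_
  rw [← smul_eq_C_mul]
  exact (totalDegree_smul_le _ _).trans (totalDegree_X i).le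

/-- The zonal polynomial with axis `a` vanishing where `a · Y ∈ S`. -/
noncomputable def zonalPoly {m : ℕ} (a : Fin m → ℝ) (S : Finset ℝ) : MvPolynomial (Fin m) ℝ :=
  ∏ s ∈ S, (linearForm a - C s)

lemma eval_zonalPoly {m : ℕ} (a y : Fin m → ℝ) (S : Finset ℝ) :
    eval y (zonalPoly a S) = ∏ s ∈ S, (a ⬝ᵥ y - s) := by
  simp [zonalPoly, map_prod, eval_linearForm]

lemma eval_zonalPoly_eq_zero_iff {m : ℕ} {a y : Fin m → ℝ} {S : Finset ℝ} :
    eval y (zonalPoly a S) = 0 ↔ a ⬝ᵥ y ∈ S := by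
  simp [eval_zonalPoly, Finset.prod_eq_zero_iff, sub_eq_zero]

lemma totalDegree_zonalPoly_le {m : ℕ} (a : Fin m → ℝ) (S : Finset ℝ) :
    (zonalPoly a S).totalDegree ≤ S.card := by
  refine (totalDegree_finsetProd _ _).trans ?_
  refine (Finset.sum_le_card_nsmul _ _ 1 fun s _ => ?_).trans (by simp)
  exact (totalDegree_sub_C_le _ _).trans (totalDegree_linearForm_le a)

/-- A polynomial divisible by `Y₁² + ⋯ + Y_m² − 1` vanishes on the unit sphere. -/
lemma eval_eq_zero_of_norm_dvd {m : ℕ} {F : MvPolynomial (Fin m) ℝ}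
    (h : ((∑ i : Fin m, X i ^ 2) - 1) ∣ F) {y : Fin m → ℝ} (hy : y ⬝ᵥ y = 1) :
    eval y F = 0 := by
  obtain ⟨G, rfl⟩ := h
  have : ∑ i, y i ^ 2 = 1 := by simpa [dotProduct, sq] using hy
  simp [this]

lemma exists_unit_orthogonal {m : ℕ} (hm : 2 ≤ m) (a : Fin m → ℝ) :
    ∃ b : Fin m → ℝ, b ⬝ᵥ b = 1 ∧ a ⬝ᵥ b = 0 := by
  have hker : LinearMap.ker (dotProductBilin ℝ ℝ a) ≠ ⊥ :=
    LinearMap.ker_ne_bot_of_finrank_lt (by simp; omega)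
  obtain ⟨v, hv, hv0⟩ := Submodule.exists_mem_ne_zero_of_ne_bot hker
  have hav : a ⬝ᵥ v = 0 := by simpa using hv
  have hpos : 0 < v ⬝ᵥ v :=
    (Finset.sum_nonneg fun i _ => mul_self_nonneg (v i)).lt_of_ne'
      fun h => hv0 (dotProduct_self_eq_zero.1 h)
  refine ⟨(√(v ⬝ᵥ v))⁻¹ • v, ?_, by simp [hav]⟩
  have hs : √(v ⬝ᵥ v) ≠ 0 := (Real.sqrt_pos.2 hpos).ne'
  have := Real.mul_self_sqrt hpos.le
  simp only [smul_dotProduct, dotProduct_smul, smul_eq_mul]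
  field_simp
  rw [sq, this]

/-- On the great circle through orthogonal unit vectors `a` and `b` some point avoids the
hyperplane `b · y = 0` and has `a · y` outside a given finite set. -/
lemma exists_unit_dotProduct_notMem {m : ℕ} {a b : Fin m → ℝ} (ha : a ⬝ᵥ a = 1)
    (hb : b ⬝ᵥ b = 1) (hab : a ⬝ᵥ b = 0) (S : Finset ℝ) :
    ∃ y : Fin m → ℝ, y ⬝ᵥ y = 1 ∧ a ⬝ᵥ y ∉ S ∧ b ⬝ᵥ y ≠ 0 := by
  obtain ⟨c, ⟨hc0, hc1⟩, hcS⟩ := (Set.Ioo_infinite (zero_lt_one' ℝ)).exists_notMem_finset S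
  have hpos : 0 < 1 - c ^ 2 := by nlinarith
  have hsq := Real.mul_self_sqrt hpos.le
  have hba : b ⬝ᵥ a = 0 := by rw [dotProduct_comm, hab]
  refine ⟨c • a + √(1 - c ^ 2) • b, ?_, ?_, ?_⟩
  · simp only [add_dotProduct, dotProduct_add, smul_dotProduct, dotProduct_smul, smul_eq_mul,
      ha, hb, hab, hba]
    linarith
  · simpa [dotProduct_add, ha, hab] using hcS
  · simpa [dotProduct_add, hb, hba] using (Real.sqrt_pos.2 hpos).ne'

lemma eq_of_unit_dotProduct_eq_one {m : ℕ} {a x : Fin m → ℝ} (ha : a ⬝ᵥ a = 1)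
    (hx : x ⬝ᵥ x = 1) (h : a ⬝ᵥ x = 1) : x = a := by
  rw [← sub_eq_zero, ← dotProduct_self_eq_zero]
  simp only [sub_dotProduct, dotProduct_sub, ha, hx, h, dotProduct_comm x a]
  norm_num

/-- A polynomial of total degree at most one is affine. -/
lemma eq_linearForm_add_C_of_totalDegree_le_one {m : ℕ} {F : MvPolynomial (Fin m) ℝ}
    (hF : F.totalDegree ≤ 1) :
    F = linearForm (fun i => coeff (Finsupp.single i 1) F) + C (coeff 0 F) := by
  ext e
  have hlin : coeff e (linearForm fun i => coeff (Finsupp.single i 1) F) =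
      ∑ i, if Finsupp.single i 1 = e then coeff (Finsupp.single i 1) F else 0 := by
    simp [linearForm, coeff_sum, coeff_C_mul, coeff_X]
  rw [coeff_add, hlin, coeff_C]
  rcases Nat.lt_or_ge 1 e.degree with he | he
  · have h1 : ∀ i, Finsupp.single i 1 ≠ e := by
      rintro i rfl
      simp at he
    have h0 : (0 : Fin m →₀ ℕ) ≠ e := by
      rintro rfl
      simp at he
    rw [coeff_eq_zero_of_totalDegree_lt (hF.trans_lt he)]
    simp [h1, h0]
  · rcases Nat.le_one_iff_eq_zero_or_eq_one.1 he with he | he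
    · obtain rfl := (Finsupp.degree_eq_zero_iff e).1 he
      simp
    · obtain ⟨j, rfl⟩ := (Finsupp.sum_eq_one_iff e).1 he
      have h0 : (0 : Fin m →₀ ℕ) ≠ Finsupp.single j 1 := by
        intro h
        simpa using congrArg (fun f => f j) h
      simp [h0, Finsupp.single_left_inj]

lemma eq_zero_of_totalDegree_le_one {m : ℕ} {X : Finset (Fin m → ℝ)} (hX : X.Nonempty)
    (hhyp : ¬ ∃ (c : Fin m → ℝ) (t : ℝ), c ≠ 0 ∧ ∀ a ∈ X, ∑ i, c i * a i = t)
    {F : MvPolynomial (Fin m) ℝ} (hF : F.totalDegree ≤ 1) (hvan : ∀ a ∈ X, eval a F = 0) :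
    F = 0 := by
  have haff := eq_linearForm_add_C_of_totalDegree_le_one hF
  set c : Fin m → ℝ := fun i => coeff (Finsupp.single i 1) F
  have hev : ∀ a ∈ X, c ⬝ᵥ a + coeff 0 F = 0 := fun a ha => by
    have := hvan a ha
    rwa [haff, map_add, eval_linearForm, eval_C] at this
  have hc : c = 0 := by
    by_contra hc
    exact hhyp ⟨c, -coeff 0 F, hc, fun a ha => eq_neg_of_add_eq_zero_left (hev a ha)⟩
  obtain ⟨a, ha⟩ := hX
  have h0 : coeff 0 F = 0 := by simpa [hc] using hev a ha
  rw [haff, hc, h0]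
  simp [linearForm]


open MvPolynomial

/-- Let `m ≥ 2` and let `X` be a finite spanning subset of the unit
sphere of `ℝ^m` whose inner product set has size `d + 1`.  Then some polynomial of total
degree at most `d + 1` vanishes on `X` and is not divisible by `Nm = Y₁² + ⋯ + Y_m² − 1`;
if `X` is antipodal, some such polynomial has total degree at most `d`.  Moreover, if `X`
lies in no affine hyperplane, then no nonzero polynomial of total degree at most `1`
vanishes on `X`, and every nonzero polynomial vanishing on `X` and not divisible by `Nm`
has total degree at least `2`.  (Thus `2 ≤ γ₁(X) ≤ d + 1`, with `γ₁(X) ≤ d` when `X` is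
antipodal.) -/
theorem statement18 (m d : ℕ) (hm : 2 ≤ m) (X : Finset (Fin m → ℝ))
    (hsphere : ∀ a ∈ X, ∑ i, a i * a i = 1)
    (hspan : Submodule.span ℝ (X : Set (Fin m → ℝ)) = ⊤)
    (hip : ((X ×ˢ X).image fun p => ∑ i, p.1 i * p.2 i).card = d + 1) :
    (∃ F : MvPolynomial (Fin m) ℝ, F.totalDegree ≤ d + 1 ∧
      (∀ a ∈ X, MvPolynomial.eval a F = 0) ∧
      ¬ ((∑ i : Fin m, MvPolynomial.X i ^ 2) - 1) ∣ F) ∧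
    ((∀ a ∈ X, -a ∈ X) →
      ∃ F : MvPolynomial (Fin m) ℝ, F.totalDegree ≤ d ∧
        (∀ a ∈ X, MvPolynomial.eval a F = 0) ∧
        ¬ ((∑ i : Fin m, MvPolynomial.X i ^ 2) - 1) ∣ F) ∧
    ((¬ ∃ (c : Fin m → ℝ) (t : ℝ), c ≠ 0 ∧ ∀ a ∈ X, ∑ i, c i * a i = t) →
      (∀ F : MvPolynomial (Fin m) ℝ, F.totalDegree ≤ 1 →
        (∀ a ∈ X, MvPolynomial.eval a F = 0) → F = 0) ∧
      (∀ F : MvPolynomial (Fin m) ℝ, F ≠ 0 →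
        (∀ a ∈ X, MvPolynomial.eval a F = 0) →
        ¬ ((∑ i : Fin m, MvPolynomial.X i ^ 2) - 1) ∣ F →
        2 ≤ F.totalDegree)) := by
  set A : Finset ℝ := (X ×ˢ X).image fun p => ∑ i, p.1 i * p.2 i
  have hA : ∀ a ∈ X, ∀ x ∈ X, a ⬝ᵥ x ∈ A := fun a ha x hx =>
    Finset.mem_image.2 ⟨(a, x), Finset.mk_mem_product ha hx, rfl⟩
  have hX : X.Nonempty := by
    rw [Finset.nonempty_iff_ne_empty]
    rintro rfl
    simp [A] at hip
  obtain ⟨a, haX⟩ := id hX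
  have ha : a ⬝ᵥ a = 1 := hsphere a haX
  obtain ⟨b, hb, hab⟩ := exists_unit_orthogonal hm a
  refine ⟨⟨zonalPoly a A, hip ▸ totalDegree_zonalPoly_le a A,
    fun x hx => eval_zonalPoly_eq_zero_iff.2 (hA a haX x hx), fun hdvd => ?_⟩, fun hanti => ?_,
    fun hhyp => ⟨fun F hF hvan => eq_zero_of_totalDegree_le_one hX hhyp hF hvan,
      fun F hF0 hvan _ => ?_⟩⟩
  · obtain ⟨y, hy, hyA, -⟩ := exists_unit_dotProduct_notMem ha hb hab A
    exact hyA (eval_zonalPoly_eq_zero_iff.1 (eval_eq_zero_of_norm_dvd hdvd hy))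
  · set B := (A.erase 1).erase (-1)
    have h1 : (1 : ℝ) ∈ A := ha ▸ hA a haX a haX
    have h2 : (-1 : ℝ) ∈ A.erase 1 :=
      Finset.mem_erase.2 ⟨by norm_num, by simpa [ha] using hA a haX (-a) (hanti a haX)⟩
    have hcard : B.card + 1 = d := by
      have e1 := Finset.card_erase_add_one h1
      have e2 : B.card + 1 = (A.erase 1).card := Finset.card_erase_add_one h2
      omega
    refine ⟨zonalPoly a B * linearForm b, ?_, fun x hx => ?_, fun hdvd => ?_⟩
    · exact (totalDegree_mul _ _).trans (hcard ▸ add_le_add (totalDegree_zonalPoly_le a B)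
        (totalDegree_linearForm_le b))
    · have hxx : x ⬝ᵥ x = 1 := hsphere x hx
      rw [map_mul, mul_eq_zero, eval_zonalPoly_eq_zero_iff, eval_linearForm, dotProduct_comm b]
      by_cases hx1 : a ⬝ᵥ x = 1
      · right
        rw [eq_of_unit_dotProduct_eq_one ha hxx hx1, hab]
      by_cases hx2 : a ⬝ᵥ x = -1
      · right
        have : -x = a := eq_of_unit_dotProduct_eq_one ha (by simpa using hxx) (by simp [hx2])
        rw [← neg_eq_zero, ← neg_dotProduct, this, hab]
      · exact Or.inl (Finset.mem_erase.2 ⟨hx2, Finset.mem_erase.2 ⟨hx1, hA a haX x hx⟩⟩)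
    · obtain ⟨y, hy, hyB, hby⟩ := exists_unit_dotProduct_notMem ha hb hab B
      have hzero := eval_eq_zero_of_norm_dvd hdvd hy
      rw [map_mul, mul_eq_zero, eval_zonalPoly_eq_zero_iff, eval_linearForm] at hzero
      exact hzero.elim hyB hby
  · by_contra! hlt
    exact hF0 (eq_zero_of_totalDegree_le_one hX hhyp (Nat.le_of_lt_succ hlt) hvan)
end

section
/- Let X be a set of n distinct points on the unit circle in ℝ², and let F ∈ ℝ[Y_1, Y_2] be a polynomial vanishing at every point of X with 2·deg F < n. Then Y_1² + Y_2² − 1 divides F. (Equivalently, any non-trivial polynomial vanishing on n points of the unit circle has degree at least ⌈n/2⌉.) -/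
open MvPolynomial

/-- Division with remainder by `Y₁² + Y₂² − 1`, with respect to the second variable. -/
lemma exists_eq_circle_mul_add {R : Type*} [CommRing R] (F : MvPolynomial (Fin 2) R) :
    ∃ (Q : MvPolynomial (Fin 2) R) (A B : Polynomial R),
      F = (X 0 ^ 2 + X 1 ^ 2 - 1) * Q
        + (Polynomial.aeval (X 0) A + X 1 * Polynomial.aeval (X 0) B) := by
  induction F using MvPolynomial.induction_on with
  | C a => exact ⟨0, Polynomial.C a, 0, by simp [MvPolynomial.algebraMap_eq]⟩
  | add p q hp hq =>
    obtain ⟨Q, A, B, h⟩ := hp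
    obtain ⟨Q', A', B', h'⟩ := hq
    refine ⟨Q + Q', A + A', B + B', ?_⟩
    rw [h, h', map_add, map_add]
    ring
  | mul_X p i hp =>
    obtain ⟨Q, A, B, h⟩ := hp
    fin_cases i
    · refine ⟨Q * X 0, A * Polynomial.X, B * Polynomial.X, ?_⟩
      simp only [h, map_mul, Polynomial.aeval_X, Fin.zero_eta]
      ring
    · refine ⟨Q * X 1 + Polynomial.aeval (X 0) B, (1 - Polynomial.X ^ 2) * B, A, ?_⟩
      simp only [h, map_mul, map_sub, map_one, map_pow, Polynomial.aeval_X, Fin.mk_one]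
      ring

lemma eval_aeval_X {R σ : Type*} [CommRing R] (a : σ → R) (i : σ) (p : Polynomial R) :
    eval a (Polynomial.aeval (X i) p) = p.eval (a i) := by
  induction p using Polynomial.induction_on' with
  | add p q hp hq => simp [hp, hq]
  | monomial n r => simp [Polynomial.aeval_monomial, MvPolynomial.algebraMap_eq]

/-- A polynomial vanishing on the whole real unit circle is divisible by its equation. -/
lemma circle_dvd_of_forall_eval_eq_zero (F : MvPolynomial (Fin 2) ℝ)
    (hF : ∀ a : Fin 2 → ℝ, a 0 ^ 2 + a 1 ^ 2 = 1 → eval a F = 0) :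
    (X 0 ^ 2 + X 1 ^ 2 - 1) ∣ F := by
  obtain ⟨Q, A, B, h⟩ := exists_eq_circle_mul_add F
  have key : ∀ x y : ℝ, x ^ 2 + y ^ 2 = 1 → A.eval x + y * B.eval x = 0 := by
    intro x y hxy
    have := hF ![x, y] (by simpa using hxy)
    rw [h] at this
    simpa [eval_aeval_X, hxy] using this
  have roots : ∀ x ∈ Set.Ioo (-1 : ℝ) 1, A.eval x = 0 ∧ B.eval x = 0 := by
    intro x hx
    have hpos : 0 < 1 - x ^ 2 := by nlinarith [hx.1, hx.2]
    have hs := Real.sq_sqrt hpos.le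
    have hs' := Real.sqrt_pos.2 hpos
    have h1 := key x (√(1 - x ^ 2)) (by linarith)
    have h2 := key x (-√(1 - x ^ 2)) (by rw [neg_sq]; linarith)
    refine ⟨by linarith, ?_⟩
    have h3 : √(1 - x ^ 2) * B.eval x = 0 := by linarith
    exact (mul_eq_zero.1 h3).resolve_left hs'.ne'
  have hinf : (Set.Ioo (-1 : ℝ) 1).Infinite := Set.Ioo_infinite (by norm_num)
  have hA : A = 0 :=
    Polynomial.eq_zero_of_infinite_isRoot A (hinf.mono fun x hx => (roots x hx).1)
  have hB : B = 0 :=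
    Polynomial.eq_zero_of_infinite_isRoot B (hinf.mono fun x hx => (roots x hx).2)
  exact ⟨Q, by simpa [hA, hB] using h⟩

/-- The restriction of `F` to the unit circle, multiplied by `z ^ deg F` and written as a
polynomial in `z = y₁ + i y₂`. -/
noncomputable def circlePolynomial (F : MvPolynomial (Fin 2) ℝ) : Polynomial ℂ :=
  ∑ m ∈ F.support, Polynomial.C ((F.coeff m : ℝ) : ℂ) *
    ((Polynomial.C (1 / 2) * (Polynomial.X ^ 2 + 1)) ^ m 0 *
      (Polynomial.C (-Complex.I / 2) * (Polynomial.X ^ 2 - 1)) ^ m 1 *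
      Polynomial.X ^ (F.totalDegree - (m 0 + m 1)))

lemma add_le_totalDegree_of_mem_support {R : Type*} [CommSemiring R]
    {F : MvPolynomial (Fin 2) R} {m : Fin 2 →₀ ℕ} (hm : m ∈ F.support) :
    m 0 + m 1 ≤ F.totalDegree := by
  have := le_totalDegree hm
  rwa [Finsupp.sum_fintype _ _ (fun _ => rfl), Fin.sum_univ_two] at this

lemma natDegree_circlePolynomial_le (F : MvPolynomial (Fin 2) ℝ) :
    (circlePolynomial F).natDegree ≤ 2 * F.totalDegree := by
  refine Polynomial.natDegree_sum_le_of_forall_le _ _ fun m hm => ?_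
  have hd := add_le_totalDegree_of_mem_support hm
  have h0 : ((Polynomial.C (1 / 2 : ℂ) * (Polynomial.X ^ 2 + 1)) ^ m 0).natDegree ≤ m 0 * 2 :=
    Polynomial.natDegree_pow_le_of_le _ (by compute_degree)
  have h1 : ((Polynomial.C (-Complex.I / 2) * (Polynomial.X ^ 2 - 1)) ^ m 1).natDegree
      ≤ m 1 * 2 :=
    Polynomial.natDegree_pow_le_of_le _ (by compute_degree)
  refine (Polynomial.natDegree_C_mul_le _ _).trans ?_
  refine (Polynomial.natDegree_mul_le_of_le (Polynomial.natDegree_mul_le_of_le h0 h1)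
    (Polynomial.natDegree_X_pow_le _)).trans ?_
  omega

lemma eval_circlePolynomial (F : MvPolynomial (Fin 2) ℝ) (a : Fin 2 → ℝ)
    (ha : a 0 ^ 2 + a 1 ^ 2 = 1) :
    (circlePolynomial F).eval (a 0 + a 1 * Complex.I)
      = (a 0 + a 1 * Complex.I) ^ F.totalDegree * (eval a F : ℝ) := by
  have ha' : (a 0 : ℂ) ^ 2 + (a 1 : ℂ) ^ 2 = 1 := by exact_mod_cast ha
  set z : ℂ := a 0 + a 1 * Complex.I with hz
  have h0 : 1 / 2 * (z ^ 2 + 1) = z * a 0 := by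
    rw [hz]
    linear_combination (-1 / 2 : ℂ) * ha' + (a 1 : ℂ) ^ 2 / 2 * Complex.I_sq
  have h1 : -Complex.I / 2 * (z ^ 2 - 1) = z * a 1 := by
    rw [hz]
    linear_combination (-Complex.I / 2) * ha'
      + (-(a 0 : ℂ) * a 1 - Complex.I * (a 1 : ℂ) ^ 2 / 2) * Complex.I_sq
  rw [circlePolynomial, Polynomial.eval_finsetSum, eval_eq', Complex.ofReal_sum,
    Finset.mul_sum]
  refine Finset.sum_congr rfl fun m hm => ?_
  have hd := add_le_totalDegree_of_mem_support hm
  simp only [Polynomial.eval_mul, Polynomial.eval_pow, Polynomial.eval_add, Polynomial.eval_sub,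
    Polynomial.eval_C, Polynomial.eval_X, Polynomial.eval_one, h0, h1, Fin.prod_univ_two,
    Complex.ofReal_mul, Complex.ofReal_pow]
  obtain ⟨k, hk⟩ := Nat.exists_eq_add_of_le hd
  rw [hk, Nat.add_sub_cancel_left, pow_add, pow_add, mul_pow, mul_pow]
  ring

/-- If `X` is a set of `n` distinct points on the unit circle in `ℝ²`
and `F ∈ ℝ[Y₁, Y₂]` vanishes at every point of `X` with `2·deg F < n`, then
`Y₁² + Y₂² − 1` divides `F`. -/
theorem statement19 (n : ℕ) (X : Finset (Fin 2 → ℝ)) (hcard : X.card = n)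
    (hcircle : ∀ a ∈ X, a 0 ^ 2 + a 1 ^ 2 = 1)
    (F : MvPolynomial (Fin 2) ℝ)
    (hvan : ∀ a ∈ X, MvPolynomial.eval a F = 0)
    (hdeg : 2 * F.totalDegree < n) :
    (MvPolynomial.X 0 ^ 2 + MvPolynomial.X 1 ^ 2 - 1) ∣ F := by
  have hinj : Function.Injective fun a : Fin 2 → ℝ => (a 0 + a 1 * Complex.I : ℂ) := by
    intro a b hab
    have hre := congrArg Complex.re hab
    have him := congrArg Complex.im hab
    ext i
    fin_cases i
    · simpa using hre
    · simpa using him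
  have hzero : circlePolynomial F = 0 := by
    refine Polynomial.eq_zero_of_natDegree_lt_card_of_eval_eq_zero' _
      (X.map ⟨_, hinj⟩) ?_ ?_
    · intro z hz
      obtain ⟨a, ha, rfl⟩ := Finset.mem_map.1 hz
      simp only [Function.Embedding.coeFn_mk]
      rw [eval_circlePolynomial F a (hcircle a ha), hvan a ha, Complex.ofReal_zero, mul_zero]
    · rw [Finset.card_map, hcard]
      exact (natDegree_circlePolynomial_le F).trans_lt hdeg
  refine circle_dvd_of_forall_eval_eq_zero F fun a ha => ?_
  have h := eval_circlePolynomial F a ha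
  rw [hzero, Polynomial.eval_zero] at h
  have hne : (a 0 + a 1 * Complex.I : ℂ) ≠ 0 := by
    intro hz
    have hre : a 0 = 0 := by simpa using congrArg Complex.re hz
    have him : a 1 = 0 := by simpa using congrArg Complex.im hz
    simp [hre, him] at ha
  exact Complex.ofReal_eq_zero.1 ((mul_eq_zero.1 h.symm).resolve_left (pow_ne_zero _ hne))
end
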